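/- arXiv:1609.06247 — 2 statements merged into one kernel-verified Lean document; each statement's English description precedes it below -/
import Mathlib

section
/- Let m = 2ν with ν a nonnegative integer. If λ belongs to the 2K-periodic spectrum of the Lamé operator L_m = -d²/dx² + m(m+1)k² sn²(x,k) and has multiplicity 1, then λ ∈ S_ν = S_{ν,1} ∪ S_{ν,2}, where S_{ν,1} and S_{ν,2} are the zero sets of the determinants δ_{ν,1}(λ) = det K_{ν,1}(λ) and δ_{ν,2}(λ) = det K_{ν,2}(λ) of the tridiagonal matrices K_{ν,1} (size (ν+1)×(ν+1)) and K_{ν,2} (size ν×ν) defined below. -/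
open Set Filter

noncomputable section

/-- `sn` is the Jacobi elliptic sine with modulus `k`: characterised as the
unique solution of `sn'' = -(1+k²)sn + 2k² sn³` with `sn 0 = 0`, `sn' 0 = 1`. -/
def IsJacobiSn (k : ℝ) (sn : ℝ → ℝ) : Prop :=
  ContDiff ℝ 2 sn ∧ sn 0 = 0 ∧ deriv sn 0 = 1 ∧
    ∀ x : ℝ, deriv (deriv sn) x = -(1 + k ^ 2) * sn x + 2 * k ^ 2 * sn x ^ 3

/-- The complete elliptic integral `K = ∫₀^{π/2} dφ/√(1 - k² sin²φ)`;
`2K` is the period of the Lamé potential `m(m+1)k² sn²(x,k)`. -/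
def ellK (k : ℝ) : ℝ := ∫ φ in (0:ℝ)..(Real.pi / 2), 1 / Real.sqrt (1 - k ^ 2 * Real.sin φ ^ 2)

/-- The Lamé potential `q(x) = m(m+1)k² sn²(x,k)`. -/
def lamePot (m : ℕ) (k : ℝ) (sn : ℝ → ℝ) : ℝ → ℝ :=
  fun x => (m * (m + 1) : ℝ) * k ^ 2 * sn x ^ 2

/-- `ψ` is a nonzero solution of `-ψ'' + qψ = λψ` with `ψ(x+T) = s·ψ(x)`
(`s = 1`: periodic; `s = -1`: antiperiodic). -/
def IsFloquetSolution (q : ℝ → ℝ) (T lam s : ℝ) (ψ : ℝ → ℝ) : Prop :=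
  ψ ≠ 0 ∧ ContDiff ℝ 2 ψ ∧
    (∀ x : ℝ, -deriv (deriv ψ) x + q x * ψ x = lam * ψ x) ∧
    ∀ x : ℝ, ψ (x + T) = s * ψ x

/-- `λ` belongs to the `T`-periodic spectrum. -/
def IsPeriodicEV (q : ℝ → ℝ) (T lam : ℝ) : Prop :=
  ∃ ψ : ℝ → ℝ, IsFloquetSolution q T lam 1 ψ

/-- `λ` belongs to the `T`-antiperiodic spectrum. -/
def IsAntiperiodicEV (q : ℝ → ℝ) (T lam : ℝ) : Prop :=
  ∃ ψ : ℝ → ℝ, IsFloquetSolution q T lam (-1) ψ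

/-- Coexistence of two linearly independent `T`-periodic solutions at `λ`
(i.e. `λ` is a periodic eigenvalue of multiplicity 2). -/
def IsDoublePeriodicEV (q : ℝ → ℝ) (T lam : ℝ) : Prop :=
  ∃ ψ₁ ψ₂ : ℝ → ℝ, LinearIndependent ℝ ![ψ₁, ψ₂] ∧
    IsFloquetSolution q T lam 1 ψ₁ ∧ IsFloquetSolution q T lam 1 ψ₂

/-- Coexistence of two linearly independent `T`-antiperiodic solutions at `λ`. -/
def IsDoubleAntiperiodicEV (q : ℝ → ℝ) (T lam : ℝ) : Prop :=
  ∃ ψ₁ ψ₂ : ℝ → ℝ, LinearIndependent ℝ ![ψ₁, ψ₂] ∧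
    IsFloquetSolution q T lam (-1) ψ₁ ∧ IsFloquetSolution q T lam (-1) ψ₂

/-- `P(z) = m(m+1)k²/4 - zk²/2 - z²k²`. -/
def lameP (m : ℕ) (k z : ℝ) : ℝ :=
  (m * (m + 1) : ℝ) * k ^ 2 / 4 - z * k ^ 2 / 2 - z ^ 2 * k ^ 2

/-- `Λ_n = λ - m(m+1)k²/2 - (1 - k²/2)·4n²`. -/
def lameL (m : ℕ) (k lam : ℝ) (n : ℕ) : ℝ :=
  lam - (m * (m + 1) : ℝ) * k ^ 2 / 2 - (1 - k ^ 2 / 2) * 4 * (n : ℝ) ^ 2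

/-- `P*(z) = m(m+1)k²/4 - (2z-1)k²/4 - (2z-1)²k²/4`. -/
def lamePs (m : ℕ) (k z : ℝ) : ℝ :=
  (m * (m + 1) : ℝ) * k ^ 2 / 4 - (2 * z - 1) * k ^ 2 / 4 - (2 * z - 1) ^ 2 * k ^ 2 / 4

/-- `Λ*_n = λ - m(m+1)k²/2 - (1 - k²/2)(2n+1)²`. -/
def lameLs (m : ℕ) (k lam : ℝ) (n : ℕ) : ℝ :=
  lam - (m * (m + 1) : ℝ) * k ^ 2 / 2 - (1 - k ^ 2 / 2) * (2 * (n : ℝ) + 1) ^ 2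

/-- The `(ν+1)×(ν+1)` tridiagonal matrix `K_{ν,1}` with diagonal `Λ₀,…,Λ_ν`,
superdiagonal `P(-1),…,P(-ν)` and subdiagonal `2P(0), P(1),…,P(ν-1)`
(here `m = 2ν`). -/
def matK1 (ν : ℕ) (k lam : ℝ) : Matrix (Fin (ν + 1)) (Fin (ν + 1)) ℝ :=
  Matrix.of fun i j =>
    if (i : ℕ) = (j : ℕ) then lameL (2 * ν) k lam (i : ℕ)
    else if (j : ℕ) = (i : ℕ) + 1 then lameP (2 * ν) k (-(((i : ℕ) : ℝ) + 1))
    else if (i : ℕ) = (j : ℕ) + 1 then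
      (if (j : ℕ) = 0 then 2 * lameP (2 * ν) k 0 else lameP (2 * ν) k ((j : ℕ) : ℝ))
    else 0

/-- The `ν×ν` tridiagonal matrix `K_{ν,2}` with diagonal `Λ₁,…,Λ_ν`,
superdiagonal `P(-2),…,P(-ν)` and subdiagonal `P(1),…,P(ν-1)` (here `m = 2ν`). -/
def matK2 (ν : ℕ) (k lam : ℝ) : Matrix (Fin ν) (Fin ν) ℝ :=
  Matrix.of fun i j =>
    if (i : ℕ) = (j : ℕ) then lameL (2 * ν) k lam ((i : ℕ) + 1)
    else if (j : ℕ) = (i : ℕ) + 1 then lameP (2 * ν) k (-(((i : ℕ) : ℝ) + 2))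
    else if (i : ℕ) = (j : ℕ) + 1 then lameP (2 * ν) k (((j : ℕ) : ℝ) + 1)
    else 0

/-- The `ν×ν` tridiagonal matrix `K*_{ν,1}` with diagonal
`P*(0)+Λ*₀, Λ*₁,…,Λ*_{ν-1}`, superdiagonal `P*(-1),…,P*(-ν+1)` and subdiagonal
`P*(1),…,P*(ν-1)` (here `m = 2ν`). -/
def matK1s (ν : ℕ) (k lam : ℝ) : Matrix (Fin ν) (Fin ν) ℝ :=
  Matrix.of fun i j =>
    if (i : ℕ) = (j : ℕ) then
      (if (i : ℕ) = 0 then lamePs (2 * ν) k 0 + lameLs (2 * ν) k lam 0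
        else lameLs (2 * ν) k lam (i : ℕ))
    else if (j : ℕ) = (i : ℕ) + 1 then lamePs (2 * ν) k (-(((i : ℕ) : ℝ) + 1))
    else if (i : ℕ) = (j : ℕ) + 1 then lamePs (2 * ν) k (((j : ℕ) : ℝ) + 1)
    else 0

/-- The `ν×ν` tridiagonal matrix `K*_{ν,2}`: identical to `K*_{ν,1}` except
that its `(1,1)` entry is `-P*(0)+Λ*₀`. -/
def matK2s (ν : ℕ) (k lam : ℝ) : Matrix (Fin ν) (Fin ν) ℝ :=
  Matrix.of fun i j =>
    if (i : ℕ) = (j : ℕ) then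
      (if (i : ℕ) = 0 then -lamePs (2 * ν) k 0 + lameLs (2 * ν) k lam 0
        else lameLs (2 * ν) k lam (i : ℕ))
    else if (j : ℕ) = (i : ℕ) + 1 then lamePs (2 * ν) k (-(((i : ℕ) : ℝ) + 1))
    else if (i : ℕ) = (j : ℕ) + 1 then lamePs (2 * ν) k (((j : ℕ) : ℝ) + 1)
    else 0


/-! ### Linear algebra: tridiagonal matrices -/

namespace LameAux

lemma tri_sum (N : ℕ) (d u l : ℕ → ℝ) (a : ℕ → ℝ) (ha : ∀ n, N ≤ n → a n = 0) (i : ℕ) (hi : i < N) :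
    ∑ j : Fin N, (if i = (j : ℕ) then d i else if (j : ℕ) = i + 1 then u i
      else if i = (j : ℕ) + 1 then l j else 0) * a j
    = (if i = 0 then 0 else l (i - 1) * a (i - 1)) + d i * a i + u i * a (i + 1) := by
  rw [Fin.sum_univ_eq_sum_range (fun j : ℕ => (if i = j then d i else if j = i + 1 then u i
      else if i = j + 1 then l j else 0) * a j) N]
  have h : ∀ j ∈ Finset.range N, (if i = j then d i else if j = i + 1 then u i
      else if i = j + 1 then l j else 0) * a j =
      (if i = j then d j * a j else 0) + (if i + 1 = j then u i * a j else 0)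
        + (if i - 1 = j then (if i = 0 then 0 else l j * a j) else 0) := by
    intro j _
    split_ifs <;> first | omega | (subst_vars; simp)
  rw [Finset.sum_congr rfl h, Finset.sum_add_distrib, Finset.sum_add_distrib,
    Finset.sum_ite_eq, Finset.sum_ite_eq, Finset.sum_ite_eq]
  have h1 : i - 1 ∈ Finset.range N := by simp; omega
  simp only [Finset.mem_range.2 hi, h1, if_true]
  by_cases h2 : i + 1 ∈ Finset.range N
  · simp only [h2, if_true]; ring
  · have : a (i + 1) = 0 := ha _ (by simpa using h2)
    simp only [h2, this, if_false]; ring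

/-- even recurrence row -/
def rowE (ν : ℕ) (k lam : ℝ) (a : ℕ → ℝ) (n : ℕ) : ℝ :=
  (if n = 0 then 0 else (if n - 1 = 0 then 2 * lameP (2 * ν) k 0 else
      lameP (2 * ν) k ((n - 1 : ℕ) : ℝ)) * a (n - 1))
    + lameL (2 * ν) k lam n * a n + lameP (2 * ν) k (-((n : ℝ) + 1)) * a (n + 1)

/-- odd recurrence row (row index `n+1`, sequence index shifted by one) -/
def rowO (ν : ℕ) (k lam : ℝ) (b : ℕ → ℝ) (n : ℕ) : ℝ :=
  (if n = 0 then 0 else lameP (2 * ν) k (((n - 1 : ℕ) : ℝ) + 1) * b (n - 1))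
    + lameL (2 * ν) k lam (n + 1) * b n + lameP (2 * ν) k (-((n : ℝ) + 2)) * b (n + 1)

lemma matK1_mulVec (ν : ℕ) (k lam : ℝ) (a : ℕ → ℝ) (ha : ∀ n, ν + 1 ≤ n → a n = 0)
    (i : Fin (ν + 1)) :
    (matK1 ν k lam).mulVec (fun j => a j) i = rowE ν k lam a i := by
  have := tri_sum (ν + 1) (fun n => lameL (2 * ν) k lam n)
    (fun n => lameP (2 * ν) k (-((n : ℝ) + 1)))
    (fun n => if n = 0 then 2 * lameP (2 * ν) k 0 else lameP (2 * ν) k (n : ℝ)) a ha i i.2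
  rw [rowE, ← this]
  rfl

lemma matK2_mulVec (ν : ℕ) (k lam : ℝ) (a : ℕ → ℝ) (ha : ∀ n, ν ≤ n → a n = 0)
    (i : Fin ν) :
    (matK2 ν k lam).mulVec (fun j => a j) i = rowO ν k lam a i := by
  have := tri_sum ν (fun n => lameL (2 * ν) k lam (n + 1))
    (fun n => lameP (2 * ν) k (-((n : ℝ) + 2)))
    (fun n => lameP (2 * ν) k ((n : ℝ) + 1)) a ha i i.2
  rw [rowO, ← this]
  rfl

/-- Abstract version: completing a tail. -/
lemma complete_tail (N : ℕ) (A : Matrix (Fin N) (Fin N) ℝ) (hA : A.det ≠ 0)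
    (row : (ℕ → ℝ) → ℕ → ℝ)
    (hadd : ∀ a b n, row (fun j => a j + b j) n = row a n + row b n)
    (hmul : ∀ a : ℕ → ℝ, (∀ n, N ≤ n → a n = 0) → ∀ i : Fin N,
      A.mulVec (fun j => a j) i = row a i)
    (hdec : ∀ a b : ℕ → ℝ, (∀ n, N ≤ n → a n = b n) → ∀ n, N ≤ n → row a n = row b n)
    (τ : ℕ → ℝ) (hτ : ∀ n, N ≤ n → row τ n = 0) :
    ∃ a : ℕ → ℝ, (∀ n, row a n = 0) ∧ ∀ n, N ≤ n → a n = τ n := by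
  set t : ℕ → ℝ := fun n => if n < N then 0 else τ n with ht
  have hu : IsUnit A.det := isUnit_iff_ne_zero.2 hA
  set v : Fin N → ℝ := A⁻¹.mulVec (fun i => - row t i) with hv
  have hAv : A.mulVec v = fun i : Fin N => - row t i := by
    rw [hv, Matrix.mulVec_mulVec, Matrix.mul_nonsing_inv _ hu, Matrix.one_mulVec]
  set w : ℕ → ℝ := fun n => if h : n < N then v ⟨n, h⟩ else 0 with hw
  have hwN : ∀ n, N ≤ n → w n = 0 := fun n hn => by simp [hw, hn]
  have hwv : (fun j : Fin N => w j) = v := by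
    funext j; simp [hw]
  have key : ∀ n, N ≤ n → w n + t n = τ n := fun n hn => by
    have : ¬ n < N := not_lt.2 hn
    simp [hw, ht, this]
  refine ⟨fun j => w j + t j, ?_, key⟩
  intro n
  by_cases hn : n < N
  · rw [hadd]
    have := hmul w hwN ⟨n, hn⟩
    rw [hwv, hAv] at this
    simp only at this
    linarith
  · have hn : N ≤ n := not_lt.1 hn
    rw [hdec _ τ key n hn, hτ n hn]

lemma zero_of_tail (N : ℕ) (A : Matrix (Fin N) (Fin N) ℝ) (hA : A.det ≠ 0)
    (row : (ℕ → ℝ) → ℕ → ℝ)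
    (hmul : ∀ a : ℕ → ℝ, (∀ n, N ≤ n → a n = 0) → ∀ i : Fin N,
      A.mulVec (fun j => a j) i = row a i)
    (a : ℕ → ℝ) (ha : ∀ n, row a n = 0) (h0 : ∀ n, N ≤ n → a n = 0) : ∀ n, a n = 0 := by
  have h : A.mulVec (fun j => a j) = 0 := by
    funext i; rw [hmul a h0 i, ha]; rfl
  have := Matrix.eq_zero_of_mulVec_eq_zero hA h
  intro n
  by_cases hn : n < N
  · exact congrFun this ⟨n, hn⟩
  · exact h0 n (not_lt.1 hn)

lemma lameP_nu (ν : ℕ) (k : ℝ) : lameP (2 * ν) k (ν : ℝ) = 0 := by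
  simp only [lameP]; push_cast; ring

lemma rowE_add (ν : ℕ) (k lam : ℝ) (a b : ℕ → ℝ) (n : ℕ) :
    rowE ν k lam (fun j => a j + b j) n = rowE ν k lam a n + rowE ν k lam b n := by
  simp only [rowE]; split_ifs <;> ring

lemma rowO_add (ν : ℕ) (k lam : ℝ) (a b : ℕ → ℝ) (n : ℕ) :
    rowO ν k lam (fun j => a j + b j) n = rowO ν k lam a n + rowO ν k lam b n := by
  simp only [rowO]; split_ifs <;> ring

lemma rowE_dec (ν : ℕ) (k lam : ℝ) (a b : ℕ → ℝ) (h : ∀ n, ν + 1 ≤ n → a n = b n) (n : ℕ)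
    (hn : ν + 1 ≤ n) : rowE ν k lam a n = rowE ν k lam b n := by
  simp only [rowE]
  rw [h n hn, h (n + 1) (by omega)]
  rcases hn.eq_or_lt with rfl | h1
  · have : lameP (2 * ν) k ((ν + 1 - 1 : ℕ) : ℝ) = 0 := lameP_nu ν k
    have h2 : ν = 0 → lameP (2 * ν) k 0 = 0 := by
      intro h; subst h; simpa using lameP_nu 0 k
    rw [this]
    rw [if_neg (Nat.succ_ne_zero ν), if_neg (Nat.succ_ne_zero ν)]
    by_cases h4 : ν + 1 - 1 = 0
    · rw [if_pos h4, h2 (by omega)]; ring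
    · rw [if_neg h4]; ring
  · rw [h (n - 1) (by omega)]

lemma rowO_dec (ν : ℕ) (k lam : ℝ) (a b : ℕ → ℝ) (h : ∀ n, ν ≤ n → a n = b n) (n : ℕ)
    (hn : ν ≤ n) : rowO ν k lam a n = rowO ν k lam b n := by
  simp only [rowO]
  rw [h n hn, h (n + 1) (by omega)]
  rcases hn.eq_or_lt with rfl | h1
  · split_ifs with h3
    · rfl
    · have : (((ν - 1 : ℕ) : ℝ) + 1) = ν := by
        have : ν - 1 + 1 = ν := by omega
        exact_mod_cast this
      rw [this, lameP_nu]; ring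
  · rw [h (n - 1) (by omega)]

lemma rowE_eq_rowO (ν : ℕ) (k lam : ℝ) (a b : ℕ → ℝ) (h : ∀ n, ν ≤ n → a (n + 1) = b n) (n : ℕ)
    (hn : ν ≤ n) : rowE ν k lam a (n + 1) = rowO ν k lam b n := by
  simp only [rowE, rowO]
  rw [h n hn, h (n + 1) (by omega)]
  have e : -(((n + 1 : ℕ) : ℝ) + 1) = -((n : ℝ) + 2) := by push_cast; ring
  rw [e]
  congr 2
  rcases hn.eq_or_lt with rfl | h1
  · rcases Nat.eq_zero_or_pos ν with rfl | h3
    · have := lameP_nu 0 k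
      simp only [Nat.cast_zero, Nat.mul_zero] at this
      simp [this]
    · have : (((ν - 1 : ℕ) : ℝ) + 1) = ν := by
        have : ν - 1 + 1 = ν := by omega
        exact_mod_cast this
      rw [this, lameP_nu]
      have h4 : ν ≠ 0 := by omega
      simp [h4, lameP_nu]
  · have e1 : (((n - 1 : ℕ) : ℝ) + 1) = n := by
      have : n - 1 + 1 = n := by omega
      exact_mod_cast this
    have e2 : a n = b (n - 1) := by
      have := h (n - 1) (by omega)
      rwa [Nat.sub_add_cancel (by omega)] at this
    have h4 : n ≠ 0 := by omega
    simp [h4, e1, e2]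

/-- From a nonzero even sequence get a nonzero odd one with the same tail. -/
lemma even_to_odd (ν : ℕ) (k lam : ℝ) (h1 : (matK1 ν k lam).det ≠ 0)
    (h2 : (matK2 ν k lam).det ≠ 0) (a : ℕ → ℝ) (ha : ∀ n, rowE ν k lam a n = 0)
    (hne : ∃ n, a n ≠ 0) :
    ∃ b : ℕ → ℝ, (∀ n, rowO ν k lam b n = 0) ∧ (∃ n, b n ≠ 0) ∧ ∀ n, ν ≤ n → b n = a (n + 1) := by
  obtain ⟨b, hb, hb'⟩ := complete_tail ν _ h2 (rowO ν k lam) (rowO_add ν k lam)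
    (matK2_mulVec ν k lam) (rowO_dec ν k lam) (fun n => a (n + 1))
    (fun n hn => by rw [← rowE_eq_rowO ν k lam a _ (fun _ _ => rfl) n hn, ha])
  refine ⟨b, hb, ?_, hb'⟩
  by_contra! h0
  obtain ⟨n, hn⟩ := hne
  apply hn
  refine zero_of_tail (ν + 1) _ h1 (rowE ν k lam) (matK1_mulVec ν k lam) a ha ?_ n
  intro j hj
  have := hb' (j - 1) (by omega)
  rw [h0, Nat.sub_add_cancel (by omega)] at this
  exact this.symm

lemma odd_to_even (ν : ℕ) (k lam : ℝ) (h1 : (matK1 ν k lam).det ≠ 0)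
    (h2 : (matK2 ν k lam).det ≠ 0) (b : ℕ → ℝ) (hb : ∀ n, rowO ν k lam b n = 0)
    (hne : ∃ n, b n ≠ 0) :
    ∃ a : ℕ → ℝ, (∀ n, rowE ν k lam a n = 0) ∧ (∃ n, a n ≠ 0) ∧ ∀ n, ν ≤ n → a (n + 1) = b n := by
  obtain ⟨a, ha, ha'⟩ := complete_tail (ν + 1) _ h1 (rowE ν k lam) (rowE_add ν k lam)
    (matK1_mulVec ν k lam) (rowE_dec ν k lam) (fun n => b (n - 1))
    (fun n hn => by
      obtain ⟨n, rfl⟩ : ∃ j, n = j + 1 := ⟨n - 1, by omega⟩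
      rw [rowE_eq_rowO ν k lam _ b (fun _ _ => rfl) n (by omega), hb])
  refine ⟨a, ha, ?_, fun n hn => ha' (n + 1) (by omega)⟩
  by_contra! h0
  obtain ⟨n, hn⟩ := hne
  apply hn
  refine zero_of_tail ν _ h2 (rowO ν k lam) (matK2_mulVec ν k lam) b hb ?_ n
  intro j hj
  have := ha' (j + 1) (by omega)
  rw [h0] at this
  exact this.symm

end LameAux

/-! ### Ince equation: Fourier coefficients and series -/

namespace LameAux

open Real intervalIntegral

/-- real-argument version of `P` -/
def PP (M k z : ℝ) : ℝ := M / 4 - z * k ^ 2 / 2 - z ^ 2 * k ^ 2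

/-- real-argument version of `Λ` -/
def LL (M k lam z : ℝ) : ℝ := lam - M / 2 - (1 - k ^ 2 / 2) * 4 * z ^ 2

/-- `φ` is a `π`-periodic solution of the Ince equation with derivatives `φ1`, `φ2`. -/
structure IsInce (k M lam : ℝ) (φ φ1 φ2 : ℝ → ℝ) : Prop where
  d1 : ∀ t, HasDerivAt φ (φ1 t) t
  d2 : ∀ t, HasDerivAt φ1 (φ2 t) t
  c2 : Continuous φ2
  per : ∀ t, φ (t + π) = φ t
  ode : ∀ t, (1 - k ^ 2 * sin t ^ 2) * φ2 t - k ^ 2 * sin t * cos t * φ1 t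
    + (lam - M * sin t ^ 2) * φ t = 0

/-- The basis functions -/
def EE (θ z t : ℝ) : ℝ := cos (2 * z * t - θ)

/-- derivative companions -/
def SS (θ z t : ℝ) : ℝ := sin (2 * z * t - θ)

lemma EE_deriv (θ z t : ℝ) : HasDerivAt (EE θ z) (-(2 * z) * SS θ z t) t := by
  have h : HasDerivAt (fun t => 2 * z * t - θ) (2 * z) t := by
    simpa using ((hasDerivAt_id t).const_mul (2 * z)).sub_const θ
  have := h.cos
  refine this.congr_deriv ?_
  unfold SS; ring

lemma SS_deriv (θ z t : ℝ) : HasDerivAt (SS θ z) (2 * z * EE θ z t) t := by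
  have h : HasDerivAt (fun t => 2 * z * t - θ) (2 * z) t := by
    simpa using ((hasDerivAt_id t).const_mul (2 * z)).sub_const θ
  have := h.sin
  refine this.congr_deriv ?_
  unfold EE; ring

lemma EE_cont (θ z : ℝ) : Continuous (EE θ z) := by unfold EE; fun_prop
lemma SS_cont (θ z : ℝ) : Continuous (SS θ z) := by unfold SS; fun_prop

lemma EE_per (θ : ℝ) (n : ℤ) (t : ℝ) : EE θ n (t + π) = EE θ n t := by
  unfold EE
  rw [← cos_add_int_mul_two_pi (2 * n * t - θ) n]; congr 1; ring

lemma SS_per (θ : ℝ) (n : ℤ) (t : ℝ) : SS θ n (t + π) = SS θ n t := by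
  unfold SS
  rw [← sin_add_int_mul_two_pi (2 * n * t - θ) n]; congr 1; ring

lemma EE_abs (θ z t : ℝ) : |EE θ z t| ≤ 1 := abs_cos_le_one _
lemma SS_abs (θ z t : ℝ) : |SS θ z t| ≤ 1 := abs_sin_le_one _

lemma EE_succ (θ z t : ℝ) : EE θ (z + 1) t = EE θ z t * cos (2 * t) - SS θ z t * sin (2 * t) := by
  unfold EE SS; rw [← cos_add]; congr 1; ring

lemma EE_pred (θ z t : ℝ) : EE θ (z - 1) t = EE θ z t * cos (2 * t) + SS θ z t * sin (2 * t) := by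
  unfold EE SS; rw [← cos_sub]; congr 1; ring

/-- The action of the operator on the basis. -/
lemma op_EE (k M lam θ z t : ℝ) :
    (1 - k ^ 2 * sin t ^ 2) * (-(2 * z) * (2 * z * EE θ z t))
      - k ^ 2 * sin t * cos t * (-(2 * z) * SS θ z t) + (lam - M * sin t ^ 2) * EE θ z t
    = PP M k z * EE θ (z + 1) t + LL M k lam z * EE θ z t + PP M k (-z) * EE θ (z - 1) t := by
  rw [EE_succ, EE_pred, sin_two_mul, cos_two_mul, cos_sq', PP, PP, LL]
  ring

/-- Adjoint action. -/
lemma adj_EE (k M lam θ z t : ℝ) :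
    (1 - k ^ 2 * sin t ^ 2) * (-(2 * z) * (2 * z * EE θ z t))
      - 3 * (k ^ 2 * sin t * cos t) * (-(2 * z) * SS θ z t)
      - k ^ 2 * (1 - 2 * sin t ^ 2) * EE θ z t
      + (lam - M * sin t ^ 2) * EE θ z t
    = PP M k (z - 1) * EE θ (z - 1) t + LL M k lam z * EE θ z t
      + PP M k (-(z + 1)) * EE θ (z + 1) t := by
  rw [EE_succ, EE_pred, sin_two_mul, cos_two_mul, cos_sq', PP, PP, LL]
  ring

lemma integral_deriv_per (f f' : ℝ → ℝ) (h : ∀ t, HasDerivAt f (f' t) t) (hc : Continuous f')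
    (hp : ∀ t, f (t + π) = f t) : ∫ t in (0:ℝ)..π, f' t = 0 := by
  rw [integral_eq_sub_of_hasDerivAt (fun x _ => h x) (hc.intervalIntegrable _ _)]
  have := hp 0
  rw [zero_add] at this
  rw [this, sub_self]

lemma deriv_per (f f' : ℝ → ℝ) (h : ∀ t, HasDerivAt f (f' t) t) 
    (hp : ∀ t, f (t + π) = f t) (t : ℝ) : f' (t + π) = f' t := by
  have h1 : HasDerivAt (fun t => f (t + π)) (f' (t + π)) t := (h (t + π)).comp_add_const t π
  have h2 : (fun t => f (t + π)) = f := funext hp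
  rw [h2] at h1
  exact h1.unique (h t)

/-- Fourier coefficients -/
def coef (φ : ℝ → ℝ) (θ : ℝ) (n : ℤ) : ℝ := ∫ t in (0:ℝ)..π, φ t * EE θ n t

lemma coef_rec {k M lam : ℝ} {φ φ1 φ2 : ℝ → ℝ} (h : IsInce k M lam φ φ1 φ2) (θ : ℝ) (n : ℤ) :
    PP M k (n - 1) * coef φ θ (n - 1) + LL M k lam n * coef φ θ n
      + PP M k (-(n + 1)) * coef φ θ (n + 1) = 0 := by
  have cφ : Continuous φ := continuous_iff_continuousAt.2 fun t => (h.d1 t).continuousAt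
  have cφ1 : Continuous φ1 := continuous_iff_continuousAt.2 fun t => (h.d2 t).continuousAt
  have ii : ∀ z : ℝ, IntervalIntegrable (fun t => φ t * EE θ z t) MeasureTheory.volume 0 π :=
    fun z => (cφ.mul (EE_cont θ z)).intervalIntegrable _ _
  unfold coef
  push_cast
  rw [← integral_const_mul, ← integral_const_mul, ← integral_const_mul,
    ← integral_add ((ii _).const_mul _) ((ii _).const_mul _),
    ← integral_add (((ii _).const_mul _).add ((ii _).const_mul _)) ((ii _).const_mul _)]
  set W : ℝ → ℝ := fun t => φ1 t * (1 - k ^ 2 * sin t ^ 2) * EE θ n t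
    - φ t * ((1 - k ^ 2 * sin t ^ 2) * (-(2 * n) * SS θ n t) - k ^ 2 * sin t * cos t * EE θ n t)
    with hW
  have hd : ∀ t, HasDerivAt W (-(PP M k (n - 1) * (φ t * EE θ (n - 1) t) +
      LL M k lam n * (φ t * EE θ n t) + PP M k (-(n + 1)) * (φ t * EE θ (n + 1) t))) t := by
    intro t
    have hs := hasDerivAt_sin t
    have hc := hasDerivAt_cos t
    have hp : HasDerivAt (fun t => 1 - k ^ 2 * sin t ^ 2) (-(k ^ 2 * (2 * sin t * cos t))) t := by
      have := ((hs.pow 2).const_mul (k ^ 2)).const_sub 1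
      refine this.congr_deriv ?_
      push_cast; ring
    have hq : HasDerivAt (fun t => k ^ 2 * sin t * cos t)
        (k ^ 2 * cos t * cos t + k ^ 2 * sin t * (- sin t)) t := (hs.const_mul (k ^ 2)).mul hc
    have := (((h.d2 t).mul hp).mul (EE_deriv θ n t)).sub ((h.d1 t).mul
      ((hp.mul ((SS_deriv θ n t).const_mul (-(2 * (n:ℝ))))).sub (hq.mul (EE_deriv θ n t))))
    refine this.congr_deriv ?_
    have e1 := h.ode t
    have e2 := adj_EE k M lam θ n t
    have e3 := cos_sq' t
    simp only [Pi.mul_apply, Pi.sub_apply]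
    linear_combination (EE θ n t) * e1 - (φ t) * e2 + k ^ 2 * φ t * EE θ n t * e3
  have hz := integral_deriv_per W _ hd (by
      have := EE_cont θ n
      have := EE_cont θ (n - 1)
      have := EE_cont θ (n + 1)
      fun_prop) (by
      intro t
      simp only [hW, EE_per, SS_per, h.per, deriv_per φ φ1 h.d1 h.per, sin_add_pi, cos_add_pi]
      ring)
  rw [integral_neg] at hz
  linarith

lemma coef_deriv2 (φ φ1 φ2 : ℝ → ℝ) (d1 : ∀ t, HasDerivAt φ (φ1 t) t)
    (d2 : ∀ t, HasDerivAt φ1 (φ2 t) t) (c2 : Continuous φ2) (per : ∀ t, φ (t + π) = φ t)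
    (θ : ℝ) (n : ℤ) : coef φ2 θ n = -(4 * (n:ℝ) ^ 2) * coef φ θ n := by
  have cφ : Continuous φ := continuous_iff_continuousAt.2 fun t => (d1 t).continuousAt
  have cE := EE_cont θ n
  have hd : ∀ t, HasDerivAt (fun t => φ1 t * EE θ n t - φ t * (-(2 * n) * SS θ n t))
      (φ2 t * EE θ n t + 4 * (n:ℝ) ^ 2 * (φ t * EE θ n t)) t := by
    intro t
    have := ((d2 t).mul (EE_deriv θ n t)).sub
      ((d1 t).mul ((SS_deriv θ n t).const_mul (-(2 * (n:ℝ)))))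
    refine this.congr_deriv ?_
    ring
  have hz := integral_deriv_per _ _ hd (by fun_prop) (by
    intro t
    simp only [EE_per, SS_per, per, deriv_per φ φ1 d1 per])
  have i1 : IntervalIntegrable (fun t => φ2 t * EE θ n t) MeasureTheory.volume 0 π :=
    (c2.mul cE).intervalIntegrable _ _
  have i2 : IntervalIntegrable (fun t => φ t * EE θ n t) MeasureTheory.volume 0 π :=
    (cφ.mul cE).intervalIntegrable _ _
  rw [integral_add i1 (i2.const_mul _), integral_const_mul] at hz
  unfold coef
  linarith

lemma ince_smooth {k M lam : ℝ} {φ φ1 φ2 : ℝ → ℝ} (hk : k ∈ Set.Ioo (0:ℝ) 1)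
    (h : IsInce k M lam φ φ1 φ2) (n : ℕ) :
    ContDiff ℝ n φ ∧ ContDiff ℝ n φ1 ∧ ContDiff ℝ n φ2 := by
  have e0 : deriv φ = φ1 := funext fun t => (h.d1 t).deriv
  have e1 : deriv φ1 = φ2 := funext fun t => (h.d2 t).deriv
  have cφ : Continuous φ := continuous_iff_continuousAt.2 fun t => (h.d1 t).continuousAt
  have cφ1 : Continuous φ1 := continuous_iff_continuousAt.2 fun t => (h.d2 t).continuousAt
  have hp : ∀ t, 1 - k ^ 2 * sin t ^ 2 ≠ 0 := by
    intro t
    have := sin_sq_le_one t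
    have := hk.1
    have := hk.2
    have : 0 < 1 - k ^ 2 * sin t ^ 2 := by nlinarith [sq_nonneg (sin t)]
    exact this.ne'
  have key : φ2 = fun t => (k ^ 2 * sin t * cos t * φ1 t - (lam - M * sin t ^ 2) * φ t) /
      (1 - k ^ 2 * sin t ^ 2) := by
    funext t
    rw [eq_div_iff (hp t)]
    linarith [h.ode t]
  have step : ∀ n : ℕ, ContDiff ℝ n φ → ContDiff ℝ n φ1 → ContDiff ℝ n φ2 := by
    intro n a b
    rw [key]
    refine ContDiff.div ?_ ?_ hp
    · have := contDiff_sin (n := n)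
      have := contDiff_cos (n := n)
      fun_prop
    · have := contDiff_sin (n := n)
      fun_prop
  induction n with
  | zero =>
    refine ⟨by simpa using cφ, by simpa using cφ1, by simpa using h.c2⟩
  | succ n ih =>
    have a : ContDiff ℝ ((n + 1 : ℕ) : WithTop ℕ∞) φ := by
      push_cast
      refine contDiff_succ_iff_deriv.2 ⟨fun t => (h.d1 t).differentiableAt, by simp, ?_⟩
      rw [e0]; exact ih.2.1
    have b : ContDiff ℝ ((n + 1 : ℕ) : WithTop ℕ∞) φ1 := by
      push_cast
      refine contDiff_succ_iff_deriv.2 ⟨fun t => (h.d2 t).differentiableAt, by simp, ?_⟩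
      rw [e1]; exact ih.2.2
    exact ⟨a, b, step _ a b⟩

lemma coef_decay {k M lam : ℝ} {φ φ1 φ2 : ℝ → ℝ} (hk : k ∈ Set.Ioo (0:ℝ) 1)
    (h : IsInce k M lam φ φ1 φ2) (θ : ℝ) : ∃ C : ℝ, 0 ≤ C ∧
    ∀ n : ℤ, (n:ℝ) ^ 4 * |coef φ θ n| ≤ C := by
  have hs : ContDiff ℝ 2 φ2 := (ince_smooth hk h 2).2.2
  have hs' : ContDiff ℝ 1 (deriv φ2) := by
    have : ContDiff ℝ (1 + 1) φ2 := by norm_num; exact hs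
    exact (contDiff_succ_iff_deriv.1 this).2.2
  have d3 : ∀ t, HasDerivAt φ2 (deriv φ2 t) t := fun t =>
    ((hs.differentiable (by norm_num)) t).hasDerivAt
  have d4 : ∀ t, HasDerivAt (deriv φ2) (deriv (deriv φ2) t) t := fun t =>
    ((hs'.differentiable (by norm_num)) t).hasDerivAt
  have c4 : Continuous (deriv (deriv φ2)) := hs'.continuous_deriv (by norm_num)
  have per2 := deriv_per φ1 φ2 h.d2 (deriv_per φ φ1 h.d1 h.per)
  obtain ⟨B, hB⟩ := (isCompact_Icc (a := (0:ℝ)) (b := π)).exists_bound_of_continuousOn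
    c4.continuousOn
  have hB0 : 0 ≤ B := (norm_nonneg _).trans (hB 0 ⟨le_rfl, pi_pos.le⟩)
  refine ⟨B * π, by positivity, fun n => ?_⟩
  have h1 := coef_deriv2 φ φ1 φ2 h.d1 h.d2 h.c2 h.per θ n
  have h2 := coef_deriv2 φ2 _ _ d3 d4 c4 per2 θ n
  have h3 : ‖coef (deriv (deriv φ2)) θ n‖ ≤ B * |π - 0| := by
    unfold coef
    apply norm_integral_le_of_norm_le_const
    intro x hx
    rw [Set.uIoc_of_le pi_pos.le] at hx
    rw [norm_mul]
    have := hB x ⟨hx.1.le, hx.2⟩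
    have h5 := EE_abs θ n x
    rw [← Real.norm_eq_abs] at h5
    nlinarith [norm_nonneg (deriv (deriv φ2) x), norm_nonneg (EE θ n x)]
  rw [h2, h1, sub_zero, abs_of_pos pi_pos] at h3
  have h6 : ‖-(4 * (n:ℝ) ^ 2) * (-(4 * (n:ℝ) ^ 2) * coef φ θ n)‖ = 16 * ((n:ℝ) ^ 4 * |coef φ θ n|) := by
    rw [show -(4 * (n:ℝ) ^ 2) * (-(4 * (n:ℝ) ^ 2) * coef φ θ n) = (16 * (n:ℝ) ^ 4) * coef φ θ n by ring,
      norm_mul, Real.norm_eq_abs, Real.norm_eq_abs, abs_of_nonneg (by positivity)]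
    ring
  rw [h6] at h3
  have : 0 ≤ (n:ℝ) ^ 4 * |coef φ θ n| := by positivity
  linarith

lemma summable_of_decay (a : ℕ → ℝ) (C : ℝ) (h : ∀ n : ℕ, (n:ℝ) ^ 4 * |a n| ≤ C) :
    Summable (fun n : ℕ => (1 + (n:ℝ) ^ 2) * |a n|) := by
  rw [← summable_nat_add_iff 1]
  have hs : Summable (fun n : ℕ => 2 * C * (1 / ((n + 1 : ℕ):ℝ) ^ 2)) :=
    ((summable_nat_add_iff 1).2 (Real.summable_one_div_nat_pow.2 one_lt_two)).mul_left _
  refine Summable.of_nonneg_of_le (fun n => by positivity) (fun n => ?_) hs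
  have h1 := h (n + 1)
  have h2 : (1:ℝ) ≤ ((n + 1 : ℕ):ℝ) ^ 2 := by
    push_cast
    have : (0:ℝ) ≤ n := Nat.cast_nonneg n
    nlinarith
  rw [mul_one_div, le_div_iff₀ (by positivity)]
  have h3 := abs_nonneg (a (n + 1))
  nlinarith [mul_nonneg (sub_nonneg.2 h2) h3, mul_nonneg (mul_nonneg (sub_nonneg.2 h2) h3) (by positivity : (0:ℝ) ≤ ((n + 1 : ℕ):ℝ) ^ 2)]

end LameAux

/-! ### Trigonometric series -/

namespace LameAux

open Real intervalIntegral

/-- three-term recurrence over `ℤ` -/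
def Rec (k M lam : ℝ) (c : ℤ → ℝ) (n : ℤ) : Prop :=
  PP M k (n - 1) * c (n - 1) + LL M k lam n * c n + PP M k (-(n + 1)) * c (n + 1) = 0

/-- the trigonometric series -/
def ser (c : ℤ → ℝ) (θ t : ℝ) : ℝ := ∑' n : ℤ, c n * EE θ n t

lemma summ_aux (c : ℤ → ℝ) (hc : Summable (fun n : ℤ => (1 + (n:ℝ) ^ 2) * |c n|)) (B : ℝ)
    (f : ℤ → ℝ) (hf : ∀ n : ℤ, |f n| ≤ B * ((1 + (n:ℝ) ^ 2) * |c n|)) : Summable f :=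
  Summable.of_norm_bounded (hc.mul_left B) hf

lemma shift_sub (f : ℤ → ℝ) (h : Summable f) : Summable fun n => f (n - 1) :=
  h.comp_injective (Equiv.subRight (1:ℤ)).injective

lemma shift_add (f : ℤ → ℝ) (h : Summable f) : Summable fun n => f (n + 1) :=
  h.comp_injective (Equiv.addRight (1:ℤ)).injective

set_option maxHeartbeats 800000 in
lemma ser_ince {k M lam : ℝ} (c : ℤ → ℝ)
    (hc : Summable (fun n : ℤ => (1 + (n:ℝ) ^ 2) * |c n|)) (hr : ∀ n, Rec k M lam c n) (θ : ℝ) :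
    ∃ φ1 φ2, IsInce k M lam (ser c θ) φ1 φ2 := by
  have b0 : ∀ (n : ℤ) t, |c n * EE θ n t| ≤ 1 * ((1 + (n:ℝ) ^ 2) * |c n|) := by
    intro n t
    rw [abs_mul]
    nlinarith [EE_abs θ n t, abs_nonneg (c n), mul_nonneg (sq_nonneg (n:ℝ)) (abs_nonneg (c n)),
      mul_nonneg (abs_nonneg (c n)) (sub_nonneg.2 (EE_abs θ n t))]
  have b1 : ∀ (n : ℤ) t, |c n * (-(2 * n) * SS θ n t)| ≤ 1 * ((1 + (n:ℝ) ^ 2) * |c n|) := by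
    intro n t
    have h1 : |-(2 * (n:ℝ))| ≤ 1 + (n:ℝ) ^ 2 := by
      rw [abs_le]; constructor <;> nlinarith [sq_nonneg ((n:ℝ) - 1), sq_nonneg ((n:ℝ) + 1)]
    have h2 : |-(2 * (n:ℝ))| * |SS θ n t| ≤ (1 + (n:ℝ) ^ 2) * 1 :=
      mul_le_mul h1 (SS_abs _ _ _) (abs_nonneg _) (by positivity)
    rw [abs_mul, abs_mul]
    nlinarith [mul_le_mul_of_nonneg_left h2 (abs_nonneg (c n))]
  have b2 : ∀ (n : ℤ) t, |c n * (-(2 * n) * (2 * n * EE θ n t))|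
      ≤ 4 * ((1 + (n:ℝ) ^ 2) * |c n|) := by
    intro n t
    have h2 : (4 * (n:ℝ) ^ 2) * |EE θ n t| ≤ (4 * (1 + (n:ℝ) ^ 2)) * 1 :=
      mul_le_mul (by linarith) (EE_abs _ _ _) (abs_nonneg _) (by positivity)
    have e : c n * (-(2 * n) * (2 * n * EE θ n t)) = -(c n * (4 * (n:ℝ) ^ 2 * EE θ n t)) := by ring
    rw [e, abs_neg, abs_mul, abs_mul, abs_of_nonneg (by positivity : 0 ≤ 4 * (n:ℝ) ^ 2)]
    nlinarith [mul_le_mul_of_nonneg_left h2 (abs_nonneg (c n))]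
  have s0 : ∀ t, Summable fun n : ℤ => c n * EE θ n t := fun t => summ_aux c hc _ _ (b0 · t)
  have s1 : ∀ t, Summable fun n : ℤ => c n * (-(2 * n) * SS θ n t) :=
    fun t => summ_aux c hc _ _ (b1 · t)
  have s2 : ∀ t, Summable fun n : ℤ => c n * (-(2 * n) * (2 * n * EE θ n t)) :=
    fun t => summ_aux c hc _ _ (b2 · t)
  refine ⟨fun t => ∑' n : ℤ, c n * (-(2 * n) * SS θ n t),
    fun t => ∑' n : ℤ, c n * (-(2 * n) * (2 * n * EE θ n t)), ?_, ?_, ?_, ?_, ?_⟩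
  · intro t
    exact hasDerivAt_tsum (hc.mul_left 1) (fun n y => (EE_deriv θ n y).const_mul (c n)) b1
      (s0 0) t
  · intro t
    exact hasDerivAt_tsum (hc.mul_left 4)
      (fun n y => ((SS_deriv θ n y).const_mul (-(2 * (n:ℝ)))).const_mul (c n)) b2 (s1 0) t
  · refine continuous_tsum (fun n => ?_) (hc.mul_left 4) b2
    have := EE_cont θ n
    fun_prop
  · intro t
    simp only [ser, EE_per]
  · intro t
    set f1 : ℤ → ℝ := fun n => c n * (PP M k n * EE θ (n + 1) t) with hf1
    set f2 : ℤ → ℝ := fun n => c n * (LL M k lam n * EE θ n t) with hf2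
    set f3 : ℤ → ℝ := fun n => c n * (PP M k (-n) * EE θ (n - 1) t) with hf3
    have gen : ∀ (A B C : ℝ) (z y : ℤ → ℝ), (∀ n : ℤ, z n = A + B * n + C * (n:ℝ) ^ 2) →
        (∀ n, |y n| ≤ 1) → Summable fun n => c n * (z n * y n) := by
      intro A B C z y hz hy
      refine summ_aux c hc (|A| + |B| + |C|) _ (fun n => ?_)
      have h1 : |z n| ≤ (|A| + |B| + |C|) * (1 + (n:ℝ) ^ 2) := by
        rw [hz]
        have hn : |(n:ℝ)| ≤ 1 + (n:ℝ) ^ 2 := by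
          rw [abs_le]; constructor <;> nlinarith [sq_nonneg ((n:ℝ) - 1), sq_nonneg ((n:ℝ) + 1)]
        calc |A + B * n + C * (n:ℝ) ^ 2| ≤ |A + B * n| + |C * (n:ℝ) ^ 2| := abs_add_le _ _
          _ ≤ |A| + |B * n| + |C * (n:ℝ) ^ 2| := by gcongr; exact abs_add_le _ _
          _ = |A| + |B| * |(n:ℝ)| + |C| * (n:ℝ) ^ 2 := by
            rw [abs_mul, abs_mul, abs_of_nonneg (sq_nonneg (n:ℝ))]
          _ ≤ _ := by
            nlinarith [abs_nonneg A, abs_nonneg B, abs_nonneg C, sq_nonneg (n:ℝ),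
              mul_le_mul_of_nonneg_left hn (abs_nonneg B),
              mul_nonneg (abs_nonneg A) (sq_nonneg (n:ℝ))]
      have h2 : |z n| * |y n| ≤ (|A| + |B| + |C|) * (1 + (n:ℝ) ^ 2) * 1 :=
        mul_le_mul h1 (hy n) (abs_nonneg _) (by positivity)
      rw [abs_mul, abs_mul]
      nlinarith [mul_le_mul_of_nonneg_left h2 (abs_nonneg (c n))]
    have g1 : Summable f1 := gen (M / 4) (-(k ^ 2 / 2)) (-(k ^ 2)) (fun n => PP M k n)
      (fun n => EE θ (n + 1) t)
      (fun n => by unfold PP; ring) (fun n => EE_abs _ _ _)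
    have g2 : Summable f2 := gen (lam - M / 2) 0 (-((1 - k ^ 2 / 2) * 4))
      (fun n => LL M k lam n) (fun n => EE θ n t)
      (fun n => by unfold LL; ring) (fun n => EE_abs _ _ _)
    have g3 : Summable f3 := gen (M / 4) (k ^ 2 / 2) (-(k ^ 2)) (fun n => PP M k (-n))
      (fun n => EE θ (n - 1) t)
      (fun n => by unfold PP; ring) (fun n => EE_abs _ _ _)
    have t1 : ∑' n, f1 (n - 1) = ∑' n, f1 n := (Equiv.subRight (1:ℤ)).tsum_eq f1
    have t3 : ∑' n, f3 (n + 1) = ∑' n, f3 n := (Equiv.addRight (1:ℤ)).tsum_eq f3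
    have g1' : Summable fun n => f1 (n - 1) := shift_sub f1 g1
    have g3' : Summable fun n => f3 (n + 1) := shift_add f3 g3
    unfold ser
    rw [← tsum_mul_left, ← tsum_mul_left, ← tsum_mul_left,
      ← ((s2 t).mul_left _).tsum_sub ((s1 t).mul_left _),
      ← (((s2 t).mul_left _).sub ((s1 t).mul_left _)).tsum_add ((s0 t).mul_left _)]
    have e1 : ∀ n : ℤ, (1 - k ^ 2 * sin t ^ 2) * (c n * (-(2 * n) * (2 * n * EE θ n t)))
        - k ^ 2 * sin t * cos t * (c n * (-(2 * n) * SS θ n t))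
        + (lam - M * sin t ^ 2) * (c n * EE θ n t) = f1 n + f2 n + f3 n := by
      intro n
      have := op_EE k M lam θ n t
      simp only [hf1, hf2, hf3]
      linear_combination c n * this
    rw [tsum_congr e1, (g1.add g2).tsum_add g3, g1.tsum_add g2, ← t1, ← t3, ← g1'.tsum_add g2,
      ← (g1'.add g2).tsum_add g3']
    have e2 : ∀ n : ℤ, f1 (n - 1) + f2 n + f3 (n + 1) = 0 := by
      intro n
      have := hr n
      unfold Rec at this
      simp only [hf1, hf2, hf3]
      push_cast
      rw [sub_add_cancel, add_sub_cancel_right]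
      linear_combination EE θ n t * this
    rw [tsum_congr e2, tsum_zero]

lemma integral_EE (θ : ℝ) (j : ℤ) :
    ∫ t in (0:ℝ)..π, EE θ j t = if j = 0 then π * cos θ else 0 := by
  split_ifs with h
  · subst h; simp [EE]
  · have hj : (j:ℝ) ≠ 0 := by exact_mod_cast h
    refine integral_deriv_per (fun t => (1 / (2 * j)) * SS θ j t) _ (fun t => ?_) (EE_cont _ _)
      (fun t => by simp only [SS_per])
    refine ((SS_deriv θ j t).const_mul (1 / (2 * (j:ℝ)))).congr_deriv ?_
    field_simp

lemma integral_EE_mul (θ : ℝ) (n N : ℤ) : ∫ t in (0:ℝ)..π, EE θ n t * EE θ N t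
    = (if n = N then π / 2 else 0) + (if n = -N then π / 2 * cos (2 * θ) else 0) := by
  have h : ∀ t, EE θ n t * EE θ N t =
      (1 / 2) * EE 0 ((n - N : ℤ) : ℝ) t + (1 / 2) * EE (2 * θ) ((n + N : ℤ) : ℝ) t := by
    intro t
    unfold EE
    have e1 : 2 * ((n - N : ℤ):ℝ) * t - 0 = (2 * n * t - θ) - (2 * N * t - θ) := by push_cast; ring
    have e2 : 2 * ((n + N : ℤ):ℝ) * t - 2 * θ = (2 * n * t - θ) + (2 * N * t - θ) := by
      push_cast; ring
    rw [e1, e2, cos_sub (2 * n * t - θ), cos_add (2 * n * t - θ)]; ring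
  simp only [h]
  rw [integral_add (((EE_cont _ _).intervalIntegrable _ _).const_mul _)
    (((EE_cont _ _).intervalIntegrable _ _).const_mul _), integral_const_mul, integral_const_mul,
    integral_EE, integral_EE, cos_zero]
  have e1 : n - N = 0 ↔ n = N := sub_eq_zero
  have e2 : n + N = 0 ↔ n = -N := add_eq_zero_iff_eq_neg
  simp only [e1, e2]
  split_ifs <;> ring

lemma coef_ser (c : ℤ → ℝ) (hc : Summable (fun n : ℤ => (1 + (n:ℝ) ^ 2) * |c n|)) (θ : ℝ) (N : ℤ) :
    coef (ser c θ) θ N = π / 2 * (c N + cos (2 * θ) * c (-N)) := by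
  have hca : Summable (fun n : ℤ => |c n|) := summ_aux c hc 1 _ (fun n => by
    rw [abs_abs]; nlinarith [abs_nonneg (c n), mul_nonneg (sq_nonneg (n:ℝ)) (abs_nonneg (c n))])
  have b0 : ∀ (n : ℤ) t, ‖c n * EE θ n t‖ ≤ |c n| := by
    intro n t
    rw [Real.norm_eq_abs, abs_mul]
    nlinarith [EE_abs θ n t, abs_nonneg (c n),
      mul_nonneg (abs_nonneg (c n)) (sub_nonneg.2 (EE_abs θ n t))]
  have h1 : HasSum (fun n : ℤ => ∫ t in (0:ℝ)..π, c n * EE θ n t * EE θ N t)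
      (∫ t in (0:ℝ)..π, ser c θ t * EE θ N t) := by
    refine hasSum_integral_of_dominated_convergence (fun n _ => |c n|) (fun n => ?_) (fun n => ?_) ?_ ?_ ?_
    · have := EE_cont θ n
      have := EE_cont θ N
      exact (by fun_prop : Continuous fun t => c n * EE θ n t * EE θ N t).aestronglyMeasurable
    · refine Filter.Eventually.of_forall fun t _ => ?_
      rw [norm_mul]
      have h2 := EE_abs θ N t
      rw [← Real.norm_eq_abs] at h2
      nlinarith [b0 n t, norm_nonneg (c n * EE θ n t), norm_nonneg (EE θ N t)]
    · exact Filter.Eventually.of_forall fun t _ => hca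
    · exact intervalIntegrable_const
    · refine Filter.Eventually.of_forall fun t _ => ?_
      exact ((Summable.of_norm_bounded hca (b0 · t)).hasSum).mul_right _
  have h2 : HasSum (fun n : ℤ => ∫ t in (0:ℝ)..π, c n * EE θ n t * EE θ N t)
      (π / 2 * (c N + cos (2 * θ) * c (-N))) := by
    have e : ∀ n : ℤ, ∫ t in (0:ℝ)..π, c n * EE θ n t * EE θ N t =
        (if n = N then π / 2 * c N else 0)
          + (if n = -N then π / 2 * cos (2 * θ) * c (-N) else 0) := by
      intro n
      simp only [mul_assoc (c n)]
      rw [integral_const_mul, integral_EE_mul]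
      split_ifs with h3 h4 h4
      · rw [← h4, ← h3]; ring
      · rw [← h3]; ring
      · rw [← h4]; ring
      · ring
    simp only [e]
    have := (hasSum_ite_eq N (π / 2 * c N)).add (hasSum_ite_eq (-N) (π / 2 * cos (2 * θ) * c (-N)))
    convert this using 1
    ring
  exact h1.unique h2

/-- completeness of the trigonometric system -/
lemma eq_zero_of_coef (f : ℝ → ℝ) (hf : Continuous f) (hp : ∀ t, f (t + π) = f t)
    (h0 : ∀ n, coef f 0 n = 0) (h1 : ∀ n, coef f (π / 2) n = 0) : ∀ t, f t = 0 := by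
  have : Fact (0 < π) := ⟨pi_pos⟩
  have hper : Function.Periodic (fun t => (f t : ℂ)) π := fun t => by simp [hp]
  let g : C(AddCircle π, ℂ) := ⟨hper.lift, by
    exact continuous_coinduced_dom.2 (by
      show Continuous fun t => (f t : ℂ)
      fun_prop)⟩
  have hg : ∀ t : ℝ, g (t : AddCircle π) = f t := fun t => rfl
  have hz : ∀ n, fourierCoeff g n = 0 := by
    intro n
    rw [fourierCoeff_eq_intervalIntegral g n 0]
    have e : ∀ t : ℝ, (fourier (-n)) (t : AddCircle π) • g (t : AddCircle π) =
        ((f t * EE 0 n t : ℝ) : ℂ) - Complex.I * ((f t * EE (π / 2) n t : ℝ) : ℂ) := by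
      intro t
      rw [hg, fourier_coe_apply, smul_eq_mul]
      have e1 : (2 * (π:ℂ) * Complex.I * ((-n : ℤ) : ℂ) * (t:ℂ) / (π:ℂ))
          = ((-(2 * n * t) : ℝ) : ℂ) * Complex.I := by
        have : (π:ℂ) ≠ 0 := by exact_mod_cast pi_ne_zero
        push_cast
        field_simp
      rw [e1, Complex.exp_mul_I, ← Complex.ofReal_cos, ← Complex.ofReal_sin]
      unfold EE
      rw [cos_sub_pi_div_two, cos_neg, sin_neg, sub_zero]
      push_cast; ring
    simp only [e]
    have c0 := EE_cont 0 n
    have c1 := EE_cont (π / 2) n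
    rw [integral_sub (Continuous.intervalIntegrable (by fun_prop) _ _)
      (Continuous.intervalIntegrable (by fun_prop) _ _), integral_const_mul, integral_ofReal,
      integral_ofReal, zero_add]
    have a0 := h0 n
    have a1 := h1 n
    unfold coef at a0 a1
    rw [a0, a1]; simp
  have hzf : fourierCoeff g = fun _ => 0 := funext hz
  intro t
  have := has_pointwise_sum_fourier_series_of_summable (f := g) (by rw [hzf]; exact summable_zero) t
  simp only [hz, zero_smul] at this
  have h := this.unique hasSum_zero
  rw [hg] at h
  exact_mod_cast h

lemma EE_neg_left_zero (z t : ℝ) : EE 0 (-z) t = EE 0 z t := by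
  unfold EE; rw [← cos_neg]; congr 1; ring

lemma EE_neg_left_pi (z t : ℝ) : EE (π / 2) (-z) t = - EE (π / 2) z t := by
  unfold EE; rw [cos_sub_pi_div_two, cos_sub_pi_div_two, ← sin_neg]; congr 1; ring

lemma coef_neg_zero (φ : ℝ → ℝ) (n : ℤ) : coef φ 0 (-n) = coef φ 0 n := by
  unfold coef; push_cast; simp only [EE_neg_left_zero]

lemma coef_neg_pi (φ : ℝ → ℝ) (n : ℤ) : coef φ (π / 2) (-n) = - coef φ (π / 2) n := by
  unfold coef; push_cast; simp only [EE_neg_left_pi, mul_neg, integral_neg]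

lemma ser_neg (c : ℤ → ℝ) (ε : ℝ) (hs : ∀ n, c (-n) = ε * c n) (θ t : ℝ) :
    ser c θ (-t) = ε * ser c θ t := by
  unfold ser
  rw [← (Equiv.neg ℤ).tsum_eq, ← tsum_mul_left]
  refine tsum_congr fun n => ?_
  have : EE θ ((-n : ℤ) : ℝ) (-t) = EE θ n t := by
    unfold EE; congr 1; push_cast; ring
  rw [Equiv.neg_apply, this, hs]; ring

lemma rec_ext {k M lam : ℝ} (c : ℤ → ℝ) (ε : ℝ) (hs : ∀ n, c (-n) = ε * c n)
    (h : ∀ n : ℕ, Rec k M lam c n) (n : ℤ) : Rec k M lam c n := by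
  obtain ⟨j, rfl | rfl⟩ := n.eq_nat_or_neg
  · exact h j
  · have := h j
    unfold Rec at this ⊢
    rw [show -(j:ℤ) - 1 = -(j + 1) by ring, show -(j:ℤ) + 1 = -(j - 1) by ring, hs, hs, hs]
    push_cast at this ⊢
    rw [show -(j:ℝ) - 1 = -(j + 1) by ring, show -(-(j:ℝ) + 1) = j - 1 by ring]
    have e : LL M k lam (-(j:ℝ)) = LL M k lam j := by unfold LL; ring
    rw [e]
    linear_combination ε * this

lemma summ_ext (c : ℤ → ℝ) (ε : ℝ) (hs : ∀ n, c (-n) = ε * c n)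
    (h : Summable (fun n : ℕ => (1 + (n:ℝ) ^ 2) * |c n|)) :
    Summable (fun n : ℤ => (1 + (n:ℝ) ^ 2) * |c n|) := by
  refine Summable.of_nat_of_neg (by simpa using h) ?_
  refine (h.mul_left |ε|).congr fun n => ?_
  rw [hs, abs_mul]; push_cast; ring

end LameAux

/-! ### From recurrences to solutions -/

namespace LameAux

open Real intervalIntegral

/-- the coupling constant `m(m+1)k²` with `m = 2ν` -/
def MM (ν : ℕ) (k : ℝ) : ℝ := (((2 * ν : ℕ) : ℝ) * (((2 * ν : ℕ) : ℝ) + 1)) * k ^ 2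

lemma lameP_eq (ν : ℕ) (k z : ℝ) : lameP (2 * ν) k z = PP (MM ν k) k z := rfl

lemma lameL_eq (ν : ℕ) (k lam : ℝ) (n : ℕ) : lameL (2 * ν) k lam n = LL (MM ν k) k lam n := rfl

lemma sol_of_seq {k M lam : ℝ} (c : ℤ → ℝ) (θ ε : ℝ) (hθ : cos (2 * θ) = ε) (hε : ε * ε = 1)
    (hs : ∀ n, c (-n) = ε * c n) (hr : ∀ n : ℕ, Rec k M lam c n)
    (h : Summable (fun n : ℕ => (1 + (n:ℝ) ^ 2) * |c n|)) (hne : ∃ n, c n ≠ 0) :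
    ∃ χ χ1 χ2, IsInce k M lam χ χ1 χ2 ∧ (∀ t, χ (-t) = ε * χ t) ∧ ∃ t, χ t ≠ 0 := by
  have hc := summ_ext c ε hs h
  obtain ⟨φ1, φ2, hI⟩ := ser_ince c hc (rec_ext c ε hs hr) θ
  refine ⟨ser c θ, φ1, φ2, hI, ser_neg c ε hs θ, ?_⟩
  by_contra! h0
  obtain ⟨n, hn⟩ := hne
  apply hn
  have h1 := coef_ser c hc θ n
  have h2 : coef (ser c θ) θ n = 0 := by
    unfold coef; simp [h0]
  rw [h2, hθ, hs] at h1
  have : c n + ε * (ε * c n) = 2 * c n := by rw [← mul_assoc, hε]; ring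
  rw [this] at h1
  have hpi := pi_pos
  have h3 : π * c n = 0 := by linarith
  exact (mul_eq_zero.1 h3).resolve_left hpi.ne'

lemma even_sol (ν : ℕ) (k lam : ℝ) (a : ℕ → ℝ) (ha : ∀ n, rowE ν k lam a n = 0)
    (h : Summable (fun n : ℕ => (1 + (n:ℝ) ^ 2) * |a n|)) (hne : ∃ n, a n ≠ 0) :
    ∃ χ χ1 χ2, IsInce k (MM ν k) lam χ χ1 χ2 ∧ (∀ t, χ (-t) = 1 * χ t) ∧ ∃ t, χ t ≠ 0 := by
  set c : ℤ → ℝ := fun n => if n = 0 then 2 * a 0 else a n.natAbs with hc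
  have hcp : ∀ n : ℕ, c ((n : ℤ) + 1) = a (n + 1) := by
    intro n
    have h1 : (n : ℤ) + 1 ≠ 0 := by omega
    have h2 : ((n : ℤ) + 1).natAbs = n + 1 := by omega
    simp only [hc, if_neg h1, h2]
  have hc0 : c 0 = 2 * a 0 := by simp [hc]
  have hs : ∀ n, c (-n) = 1 * c n := by intro n; simp [hc]
  refine sol_of_seq c 0 1 (by simp) (by norm_num) hs ?_ ?_ ?_
  · intro n
    have hn := ha n
    unfold Rec
    simp only [rowE, lameP_eq, lameL_eq] at hn
    rcases n with _ | _ | n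
    · have e1 : c (((0:ℕ):ℤ) - 1) = a 1 := by
        have := hcp 0
        have h2 := hs 1
        simp only [Nat.cast_zero, zero_add] at this
        simp only [Nat.cast_zero, zero_sub]
        rw [h2, this, one_mul]
      rw [e1, hcp 0]
      simp only [Nat.cast_zero, hc0] at hn ⊢
      simp only [if_true, Int.cast_zero, zero_add, zero_sub] at hn ⊢
      linear_combination 2 * hn
    · have e2 := hcp 1
      have e1 := hcp 0
      simp only [Nat.cast_zero, Nat.cast_one, zero_add] at e1 e2 hn ⊢
      rw [e2, e1, sub_self, hc0]
      simp at hn ⊢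
      linear_combination hn
    · have e2 := hcp (n + 2)
      have e1 := hcp (n + 1)
      have e0 := hcp n
      have i0 : ((n + 1 + 1 : ℕ) : ℤ) - 1 = n + 1 := by push_cast; ring
      have i1 : ((n + 1 + 1 : ℕ) : ℤ) = ((n + 1 : ℕ) : ℤ) + 1 := by push_cast; ring
      have e2' : c (((n + 1 + 1 : ℕ) : ℤ) + 1) = a (n + 3) := e2
      rw [i0, e0, e2', i1, e1]
      simp at hn ⊢
      convert hn using 3
  · rw [← summable_nat_add_iff 1] at h ⊢
    refine h.congr fun n => ?_
    have := hcp n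
    push_cast
    rw [this]
  · obtain ⟨n, hn⟩ := hne
    rcases n with _ | n
    · exact ⟨0, by rw [hc0]; simpa using hn⟩
    · exact ⟨n + 1, by rw [hcp]; exact hn⟩

lemma odd_sol (ν : ℕ) (k lam : ℝ) (b : ℕ → ℝ) (hb : ∀ n, rowO ν k lam b n = 0)
    (h : Summable (fun n : ℕ => (1 + ((n + 1 : ℕ):ℝ) ^ 2) * |b n|)) (hne : ∃ n, b n ≠ 0) :
    ∃ χ χ1 χ2, IsInce k (MM ν k) lam χ χ1 χ2 ∧ (∀ t, χ (-t) = (-1) * χ t) ∧ ∃ t, χ t ≠ 0 := by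
  set c : ℤ → ℝ := fun n => (n.sign : ℝ) * b (n.natAbs - 1) with hc
  have hcp : ∀ n : ℕ, c ((n : ℤ) + 1) = b n := by
    intro n
    have h1 : ((n : ℤ) + 1).sign = 1 := Int.sign_eq_one_of_pos (by omega)
    have h2 : ((n : ℤ) + 1).natAbs - 1 = n := by omega
    simp only [hc, h1, h2, Int.cast_one, one_mul]
  have hc0 : c 0 = 0 := by simp [hc]
  have hs : ∀ n, c (-n) = (-1) * c n := by intro n; simp [hc]
  refine sol_of_seq c (π / 2) (-1) (by rw [mul_div_cancel₀ _ two_ne_zero, cos_pi]) (by norm_num)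
    hs ?_ ?_ ?_
  · intro n
    unfold Rec
    rcases n with _ | n
    · have h2 := hs 1
      simp only [Nat.cast_zero, zero_sub, zero_add, Int.cast_zero, hc0, h2]
      ring
    have hn := hb n
    simp only [rowO, lameP_eq, lameL_eq] at hn
    rcases n with _ | n
    · have e2 := hcp 1
      have e1 := hcp 0
      simp only [Nat.cast_zero, Nat.cast_one, zero_add] at e1 e2 hn ⊢
      rw [e2, e1, sub_self, hc0]
      simp at hn ⊢
      rw [show (-1 + -1 : ℝ) = -2 by norm_num]
      linear_combination hn
    · have e2 := hcp (n + 2)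
      have e1 := hcp (n + 1)
      have e0 := hcp n
      have i0 : ((n + 1 + 1 : ℕ) : ℤ) - 1 = n + 1 := by push_cast; ring
      have i1 : ((n + 1 + 1 : ℕ) : ℤ) = ((n + 1 : ℕ) : ℤ) + 1 := by push_cast; ring
      have e2' : c (((n + 1 + 1 : ℕ) : ℤ) + 1) = b (n + 2) := e2
      rw [i0, e0, e2', i1, e1]
      simp at hn ⊢
      rw [show (-1 + (-1 + (-1 + -(n:ℝ)))) = -2 + (-1 + -(n:ℝ)) by ring]
      linear_combination hn
  · rw [← summable_nat_add_iff 1]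
    refine h.congr fun n => ?_
    have := hcp n
    push_cast
    rw [this]
  · obtain ⟨n, hn⟩ := hne
    exact ⟨n + 1, by rw [hcp]; exact hn⟩

lemma rowE_of_coef {ν : ℕ} {k lam : ℝ} {φ φ1 φ2 : ℝ → ℝ}
    (h : IsInce k (MM ν k) lam φ φ1 φ2) (n : ℕ) :
    rowE ν k lam (fun n => if n = 0 then coef φ 0 0 / 2 else coef φ 0 n) n = 0 := by
  have hr := coef_rec h 0 n
  simp only [rowE, lameP_eq, lameL_eq]
  rcases n with _ | _ | n
  · have := coef_neg_zero φ 1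
    simp only [Nat.cast_zero, zero_sub, zero_add, Int.cast_zero, this] at hr
    simp
    linear_combination hr / 2
  · simp at hr ⊢
    linear_combination hr
  · have i0 : ((n + 1 + 1 : ℕ) : ℤ) - 1 = ((n + 1 : ℕ) : ℤ) := by push_cast; ring
    have r0 : (((n + 1 + 1 : ℕ) : ℤ) : ℝ) - 1 = n + 1 := by push_cast; ring
    rw [i0, r0] at hr
    simp at hr ⊢
    linear_combination hr

lemma rowO_of_coef {ν : ℕ} {k lam : ℝ} {φ φ1 φ2 : ℝ → ℝ}
    (h : IsInce k (MM ν k) lam φ φ1 φ2) (n : ℕ) :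
    rowO ν k lam (fun n => coef φ (π / 2) (n + 1)) n = 0 := by
  have hr := coef_rec h (π / 2) (n + 1)
  simp only [rowO, lameP_eq, lameL_eq]
  have h0 : coef φ (π / 2) 0 = 0 := by
    have := coef_neg_pi φ 0
    rw [neg_zero] at this
    linarith
  have r : -((n:ℝ) + 1 + 1) = -((n:ℝ) + 2) := by ring
  rcases n with _ | n
  · simp at hr ⊢
    rw [h0, show (-1 + -1 : ℝ) = -2 by norm_num] at hr
    linear_combination hr
  · have i0 : ((n + 1 : ℕ) : ℤ) + 1 - 1 = n + 1 := by push_cast; ring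
    rw [i0] at hr
    push_cast at hr r
    rw [r] at hr
    simp at hr ⊢
    linear_combination hr

lemma ince_both {ν : ℕ} {k lam : ℝ} {φ φ1 φ2 : ℝ → ℝ} (hk : k ∈ Set.Ioo (0:ℝ) 1)
    (h : IsInce k (MM ν k) lam φ φ1 φ2) (hne : ∃ t, φ t ≠ 0)
    (h1 : (matK1 ν k lam).det ≠ 0) (h2 : (matK2 ν k lam).det ≠ 0) :
    (∃ χ χ1 χ2, IsInce k (MM ν k) lam χ χ1 χ2 ∧ (∀ t, χ (-t) = 1 * χ t) ∧ ∃ t, χ t ≠ 0) ∧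
    (∃ χ χ1 χ2, IsInce k (MM ν k) lam χ χ1 χ2 ∧ (∀ t, χ (-t) = (-1) * χ t) ∧ ∃ t, χ t ≠ 0) := by
  have cφ : Continuous φ := continuous_iff_continuousAt.2 fun t => (h.d1 t).continuousAt
  by_cases hE : ∀ n, coef φ 0 n = 0
  · have hO : ∃ n, coef φ (π / 2) n ≠ 0 := by
      by_contra! hO
      obtain ⟨t, ht⟩ := hne
      exact ht (eq_zero_of_coef φ cφ h.per hE hO t)
    set b : ℕ → ℝ := fun n => coef φ (π / 2) (n + 1) with hb
    have hbne : ∃ n, b n ≠ 0 := by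
      by_contra! h0
      obtain ⟨n, hn⟩ := hO
      apply hn
      have hz : coef φ (π / 2) 0 = 0 := by
        have := coef_neg_pi φ 0
        rw [neg_zero] at this
        linarith
      have hnat : ∀ j : ℕ, coef φ (π / 2) j = 0 := by
        intro j
        rcases j with _ | j
        · exact hz
        · have := h0 j
          simpa [hb] using this
      obtain ⟨j, rfl | rfl⟩ := n.eq_nat_or_neg
      · exact hnat j
      · rw [coef_neg_pi, hnat, neg_zero]
    have hsb : Summable (fun n : ℕ => (1 + ((n + 1 : ℕ):ℝ) ^ 2) * |b n|) := by
      obtain ⟨C, _, hC⟩ := coef_decay hk h (π / 2)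
      have := summable_of_decay (fun n => coef φ (π / 2) n) C (fun n => by simpa using hC n)
      rw [← summable_nat_add_iff 1] at this
      refine this.congr fun n => ?_
      simp [hb]
    have hbr := rowO_of_coef h
    obtain ⟨a, ha, hane, hab⟩ := odd_to_even ν k lam h1 h2 b hbr hbne
    refine ⟨even_sol ν k lam a ha ?_ hane, odd_sol ν k lam b hbr hsb hbne⟩
    rw [← summable_nat_add_iff (ν + 1)]
    rw [← summable_nat_add_iff ν] at hsb
    refine hsb.congr fun n => ?_
    rw [← add_assoc, hab _ (by omega)]
  · push Not at hE
    set a : ℕ → ℝ := fun n => if n = 0 then coef φ 0 0 / 2 else coef φ 0 n with ha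
    have hane : ∃ n, a n ≠ 0 := by
      by_contra! h0
      obtain ⟨n, hn⟩ := hE
      apply hn
      have hnat : ∀ j : ℕ, coef φ 0 j = 0 := by
        intro j
        have := h0 j
        rcases j with _ | j
        · simp [ha] at this ⊢; exact this
        · simpa [ha] using this
      obtain ⟨j, rfl | rfl⟩ := n.eq_nat_or_neg
      · exact hnat j
      · rw [coef_neg_zero, hnat]
    have hsa : Summable (fun n : ℕ => (1 + (n:ℝ) ^ 2) * |a n|) := by
      obtain ⟨C, hC0, hC⟩ := coef_decay hk h 0
      refine summable_of_decay a C (fun n => ?_)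
      rcases n with _ | n
      · simpa using hC0
      · simpa [ha] using hC (n + 1)
    have har := rowE_of_coef h
    obtain ⟨b, hb, hbne, hab⟩ := even_to_odd ν k lam h1 h2 a har hane
    refine ⟨even_sol ν k lam a har hsa hane, odd_sol ν k lam b hb ?_ hbne⟩
    rw [← summable_nat_add_iff ν]
    rw [← summable_nat_add_iff (ν + 1)] at hsa
    refine hsa.congr fun n => ?_
    rw [← add_assoc, hab _ (by omega)]

end LameAux

/-! ### Change of variables -/

namespace LameAux

open Real intervalIntegral

/-- `√(1 - k² sin² t)` -/
def dn (k t : ℝ) : ℝ := sqrt (1 - k ^ 2 * sin t ^ 2)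

lemma p_pos {k : ℝ} (hk : k ∈ Set.Ioo (0:ℝ) 1) (t : ℝ) : 0 < 1 - k ^ 2 * sin t ^ 2 := by
  have := sin_sq_le_one t
  have := hk.1
  have := hk.2
  nlinarith [sq_nonneg (sin t)]

lemma dn_pos {k : ℝ} (hk : k ∈ Set.Ioo (0:ℝ) 1) (t : ℝ) : 0 < dn k t := sqrt_pos.2 (p_pos hk t)

lemma dn_sq {k : ℝ} (hk : k ∈ Set.Ioo (0:ℝ) 1) (t : ℝ) : dn k t ^ 2 = 1 - k ^ 2 * sin t ^ 2 :=
  sq_sqrt (p_pos hk t).le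

lemma dn_le_one (k t : ℝ) : dn k t ≤ 1 := by
  unfold dn
  refine Real.sqrt_le_iff.2 ⟨by norm_num, ?_⟩
  nlinarith [mul_nonneg (sq_nonneg k) (sq_nonneg (sin t))]

lemma dn_cont (k : ℝ) : Continuous (dn k) := by unfold dn; fun_prop

lemma dn_deriv {k : ℝ} (hk : k ∈ Set.Ioo (0:ℝ) 1) (t : ℝ) :
    HasDerivAt (dn k) (-(k ^ 2 * sin t * cos t) / dn k t) t := by
  have hp : HasDerivAt (fun t => 1 - k ^ 2 * sin t ^ 2) (-(k ^ 2 * (2 * sin t * cos t))) t := by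
    have := (((hasDerivAt_sin t).pow 2).const_mul (k ^ 2)).const_sub 1
    refine this.congr_deriv ?_
    push_cast; ring
  refine (hp.sqrt (p_pos hk t).ne').congr_deriv ?_
  have := dn_pos hk t
  change -(k ^ 2 * (2 * sin t * cos t)) / (2 * dn k t) = _
  field_simp

/-- incomplete elliptic integral -/
def FF (k t : ℝ) : ℝ := ∫ φ in (0:ℝ)..t, 1 / sqrt (1 - k ^ 2 * sin φ ^ 2)

lemma inv_dn_cont {k : ℝ} (hk : k ∈ Set.Ioo (0:ℝ) 1) :
    Continuous fun t => 1 / sqrt (1 - k ^ 2 * sin t ^ 2) :=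
  continuous_const.div (dn_cont k) fun t => (dn_pos hk t).ne'

lemma FF_deriv {k : ℝ} (hk : k ∈ Set.Ioo (0:ℝ) 1) (t : ℝ) : HasDerivAt (FF k) (1 / dn k t) t :=
  ((inv_dn_cont hk).integral_hasStrictDerivAt 0 t).hasDerivAt

lemma FF_zero (k : ℝ) : FF k 0 = 0 := by simp [FF]

lemma FF_add_pi {k : ℝ} (hk : k ∈ Set.Ioo (0:ℝ) 1) (t : ℝ) : FF k (t + π) = FF k t + 2 * ellK k := by
  have hi : ∀ a b, IntervalIntegrable (fun t => 1 / sqrt (1 - k ^ 2 * sin t ^ 2))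
      MeasureTheory.volume a b := fun a b => (inv_dn_cont hk).intervalIntegrable a b
  have hper : Function.Periodic (fun t => 1 / sqrt (1 - k ^ 2 * sin t ^ 2)) π := by
    intro t; simp [sin_add_pi]
  have h1 : FF k (t + π) = FF k t + ∫ φ in t..(t + π), 1 / sqrt (1 - k ^ 2 * sin φ ^ 2) :=
    (integral_add_adjacent_intervals (hi 0 t) (hi t (t + π))).symm
  rw [h1, hper.intervalIntegral_add_eq t 0, zero_add,
    ← integral_add_adjacent_intervals (hi 0 (π / 2)) (hi (π / 2) π)]
  have h2 := integral_comp_sub_left (a := 0) (b := π / 2)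
    (fun t => 1 / sqrt (1 - k ^ 2 * sin t ^ 2)) π
  simp only [sin_pi_sub, sub_zero] at h2
  rw [show π - π / 2 = π / 2 by ring] at h2
  rw [← h2]
  unfold ellK
  ring

lemma FF_strictMono {k : ℝ} (hk : k ∈ Set.Ioo (0:ℝ) 1) : StrictMono (FF k) := by
  apply strictMono_of_deriv_pos
  intro t
  rw [(FF_deriv hk t).deriv]
  exact one_div_pos.2 (dn_pos hk t)

lemma FF_surj {k : ℝ} (hk : k ∈ Set.Ioo (0:ℝ) 1) : Function.Surjective (FF k) := by
  have hc : Continuous (FF k) :=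
    continuous_iff_continuousAt.2 fun t => (FF_deriv hk t).continuousAt
  have hm : Monotone (fun t => FF k t - t) := by
    apply monotone_of_deriv_nonneg
    · intro t; exact ((FF_deriv hk t).sub (hasDerivAt_id t)).differentiableAt
    · intro t
      have := ((FF_deriv hk t).sub (hasDerivAt_id t)).deriv
      change 0 ≤ deriv (FF k - id) t
      rw [this, sub_nonneg]
      rw [le_div_iff₀ (dn_pos hk t), one_mul]
      exact dn_le_one k t
  refine hc.surjective ?_ ?_
  · refine Filter.tendsto_atTop_mono' _ ?_ Filter.tendsto_id
    filter_upwards [Filter.eventually_ge_atTop (0:ℝ)] with t ht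
    have := hm ht
    simp only [FF_zero] at this
    simp only [id]
    linarith
  · refine Filter.tendsto_atBot_mono' _ ?_ Filter.tendsto_id
    filter_upwards [Filter.eventually_le_atBot (0:ℝ)] with t ht
    have := hm ht
    simp only [FF_zero] at this
    simp only [id]
    linarith

/-- existence of the amplitude function -/
lemma exists_am {k : ℝ} (hk : k ∈ Set.Ioo (0:ℝ) 1) : ∃ G : ℝ → ℝ,
    (∀ t, G (FF k t) = t) ∧ (∀ x, FF k (G x) = x) ∧ (∀ x, HasDerivAt G (dn k (G x)) x) ∧
    (∀ x, G (x + 2 * ellK k) = G x + π) := by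
  let e := (FF_strictMono hk).orderIsoOfSurjective (FF k) (FF_surj hk)
  have he : ∀ t, e t = FF k t := fun t => rfl
  have l : ∀ t, e.symm (FF k t) = t := fun t => by rw [← he]; exact e.symm_apply_apply t
  have r : ∀ x, FF k (e.symm x) = x := fun x => by rw [← he]; exact e.apply_symm_apply x
  refine ⟨e.symm, l, r, ?_, ?_⟩
  · intro x
    have hd := FF_deriv hk (e.symm x)
    have := HasDerivAt.of_local_left_inverse (f := FF k) (g := e.symm) (a := x)
      e.symm.continuous.continuousAt hd (one_div_pos.2 (dn_pos hk _)).ne'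
      (Filter.Eventually.of_forall r)
    simpa using this
  · intro x
    rw [← l (e.symm x + π), FF_add_pi hk, r]

/-- uniqueness for the linear second order equation -/
lemma linear_unique (c u u1 : ℝ → ℝ) (hc : Continuous c) (d1 : ∀ x, HasDerivAt u (u1 x) x)
    (d2 : ∀ x, HasDerivAt u1 (c x * u x) x) (h0 : u 0 = 0) (h1 : u1 0 = 0) (x : ℝ) : u x = 0 := by
  set R : ℝ := |x| + 1 with hR
  have hRpos : 0 < R := by positivity
  obtain ⟨B, hB⟩ := (isCompact_Icc (a := -R) (b := R)).exists_bound_of_continuousOn hc.continuousOn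
  have hB0 : 0 ≤ B := (norm_nonneg _).trans (hB 0 ⟨by linarith, by linarith⟩)
  let v : ℝ → ℝ × ℝ → ℝ × ℝ := fun t p => (p.2, c t * p.1)
  have hv : ∀ t ∈ Set.Ioo (-R) R, LipschitzOnWith (Real.toNNReal (B + 1)) (v t) Set.univ := by
    intro t ht
    refine LipschitzOnWith.of_dist_le_mul fun p _ q _ => ?_
    rw [Real.coe_toNNReal _ (by linarith)]
    have h2 := hB t ⟨ht.1.le, ht.2.le⟩
    have a1 : dist p.1 q.1 ≤ dist p q := by rw [Prod.dist_eq]; exact le_max_left _ _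
    have a2 : dist p.2 q.2 ≤ dist p q := by rw [Prod.dist_eq]; exact le_max_right _ _
    have a3 : 0 ≤ dist p q := dist_nonneg
    rw [Prod.dist_eq]
    refine max_le ?_ ?_
    · change dist p.2 q.2 ≤ _
      nlinarith
    · change dist (c t * p.1) (c t * q.1) ≤ _
      rw [Real.dist_eq, ← mul_sub, abs_mul, ← Real.dist_eq]
      rw [Real.norm_eq_abs] at h2
      have := mul_le_mul h2 a1 dist_nonneg hB0
      linarith
  have := ODE_solution_unique_of_mem_Ioo (v := v) (s := fun _ => Set.univ)
    (f := fun t => (u t, u1 t)) (g := fun _ => (0, 0)) (t₀ := 0) hv ⟨by linarith, hRpos⟩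
    (fun t _ => ⟨(d1 t).prodMk (d2 t), trivial⟩)
    (fun t _ => ⟨by
      have : v t (0, 0) = 0 := by simp [v]
      rw [this]; exact hasDerivAt_const t _, trivial⟩) (by simp [h0, h1])
  have hx : x ∈ Set.Ioo (-R) R := by
    constructor
    · linarith [neg_abs_le x]
    · linarith [le_abs_self x]
  exact congrArg Prod.fst (this hx)

lemma sn_eq {k : ℝ} (hk : k ∈ Set.Ioo (0:ℝ) 1) {sn : ℝ → ℝ} (hsn : IsJacobiSn k sn)
    (G : ℝ → ℝ) (hG0 : G 0 = 0) (hG : ∀ x, HasDerivAt G (dn k (G x)) x) (x : ℝ) :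
    sn x = sin (G x) := by
  obtain ⟨hC, hs0, hs1, hode⟩ := hsn
  have hs' : ContDiff ℝ 1 (deriv sn) := by
    have : ContDiff ℝ (1 + 1) sn := by norm_num; exact hC
    exact (contDiff_succ_iff_deriv.1 this).2.2
  have a1 : ∀ x, HasDerivAt sn (deriv sn x) x := fun x =>
    ((hC.differentiable (by norm_num)) x).hasDerivAt
  have a2 : ∀ x, HasDerivAt (deriv sn) (deriv (deriv sn) x) x := fun x =>
    ((hs'.differentiable (by norm_num)) x).hasDerivAt
  have cG : Continuous G := continuous_iff_continuousAt.2 fun t => (hG t).continuousAt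
  have b1 : ∀ x, HasDerivAt (fun x => sin (G x)) (cos (G x) * dn k (G x)) x := fun x =>
    (hG x).sin
  have b2 : ∀ x, HasDerivAt (fun x => cos (G x) * dn k (G x))
      (-(1 + k ^ 2) * sin (G x) + 2 * k ^ 2 * sin (G x) ^ 3) x := by
    intro x
    have hd := (dn_deriv hk (G x)).comp x (hG x)
    refine ((hG x).cos.mul hd).congr_deriv ?_
    have hp := dn_pos hk (G x)
    have hq := dn_sq hk (G x)
    have hc := cos_sq' (G x)
    simp only [Function.comp]
    rw [div_mul_cancel₀ _ hp.ne']
    linear_combination (-sin (G x)) * hq - k ^ 2 * sin (G x) * hc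
  have key := linear_unique
    (fun x => -(1 + k ^ 2) + 2 * k ^ 2 * (sn x ^ 2 + sn x * sin (G x) + sin (G x) ^ 2))
    (fun x => sn x - sin (G x)) (fun x => deriv sn x - cos (G x) * dn k (G x))
    (by have := hC.continuous; fun_prop) (fun x => (a1 x).sub (b1 x))
    (fun x => by
      refine ((a2 x).sub (b2 x)).congr_deriv ?_
      rw [hode]; ring)
    (by simp [hs0, hG0]) (by simp [hs1, hG0, dn]) x
  linarith

lemma ince_of_lame {ν : ℕ} {k : ℝ} (hk : k ∈ Set.Ioo (0:ℝ) 1) {sn : ℝ → ℝ} {lam : ℝ}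
    (hsF : ∀ t, sn (FF k t) = sin t) {ψ : ℝ → ℝ}
    (h : IsFloquetSolution (lamePot (2 * ν) k sn) (2 * ellK k) lam 1 ψ) :
    ∃ φ1 φ2, IsInce k (MM ν k) lam (fun t => ψ (FF k t)) φ1 φ2 := by
  obtain ⟨_, hC, hode, hper⟩ := h
  have hs' : ContDiff ℝ 1 (deriv ψ) := by
    have : ContDiff ℝ (1 + 1) ψ := by norm_num; exact hC
    exact (contDiff_succ_iff_deriv.1 this).2.2
  have a1 : ∀ x, HasDerivAt ψ (deriv ψ x) x := fun x =>
    ((hC.differentiable (by norm_num)) x).hasDerivAt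
  have a2 : ∀ x, HasDerivAt (deriv ψ) (deriv (deriv ψ) x) x := fun x =>
    ((hs'.differentiable (by norm_num)) x).hasDerivAt
  have c0 : Continuous (deriv ψ) := hs'.continuous
  have c2 : Continuous (deriv (deriv ψ)) := hs'.continuous_deriv (by norm_num)
  have cF : Continuous (FF k) :=
    continuous_iff_continuousAt.2 fun t => (FF_deriv hk t).continuousAt
  have cd := dn_cont k
  refine ⟨fun t => deriv ψ (FF k t) / dn k t,
    fun t => (deriv (deriv ψ) (FF k t) * (1 / dn k t) * dn k t
      - deriv ψ (FF k t) * (-(k ^ 2 * sin t * cos t) / dn k t)) / dn k t ^ 2, ?_, ?_, ?_, ?_, ?_⟩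
  · intro t
    refine ((a1 (FF k t)).comp t (FF_deriv hk t)).congr_deriv ?_
    rw [mul_one_div]
  · intro t
    exact ((a2 (FF k t)).comp t (FF_deriv hk t)).div (dn_deriv hk t) (dn_pos hk t).ne'
  · have hne : ∀ t, dn k t ≠ 0 := fun t => (dn_pos hk t).ne'
    have hne2 : ∀ t, dn k t ^ 2 ≠ 0 := fun t => pow_ne_zero _ (hne t)
    fun_prop (disch := assumption)
  · intro t
    simp only [FF_add_pi hk, hper, one_mul]
  · intro t
    have hp := dn_pos hk t
    have ho := hode (FF k t)
    have e : lamePot (2 * ν) k sn (FF k t) = MM ν k * sin t ^ 2 := by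
      simp only [lamePot, hsF, MM]
    rw [e] at ho
    rw [← dn_sq hk t]
    field_simp
    linear_combination -(dn k t) * ho

lemma lame_of_ince {ν : ℕ} {k : ℝ} (hk : k ∈ Set.Ioo (0:ℝ) 1) {sn : ℝ → ℝ} {lam : ℝ}
    {G : ℝ → ℝ} (hGF : ∀ t, G (FF k t) = t) (hG : ∀ x, HasDerivAt G (dn k (G x)) x)
    (hGp : ∀ x, G (x + 2 * ellK k) = G x + π) (hsG : ∀ x, sn x = sin (G x))
    {χ χ1 χ2 : ℝ → ℝ} (h : IsInce k (MM ν k) lam χ χ1 χ2) (hne : ∃ t, χ t ≠ 0) :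
    IsFloquetSolution (lamePot (2 * ν) k sn) (2 * ellK k) lam 1 (fun x => χ (G x)) := by
  have cG : Continuous G := continuous_iff_continuousAt.2 fun t => (hG t).continuousAt
  have b1 : ∀ x, HasDerivAt (fun x => χ (G x)) (χ1 (G x) * dn k (G x)) x := fun x =>
    (h.d1 (G x)).comp x (hG x)
  have b2 : ∀ x, HasDerivAt (fun x => χ1 (G x) * dn k (G x))
      ((MM ν k * sin (G x) ^ 2 - lam) * χ (G x)) x := by
    intro x
    have hd := (dn_deriv hk (G x)).comp x (hG x)
    refine (((h.d2 (G x)).comp x (hG x)).mul hd).congr_deriv ?_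
    have hp := dn_pos hk (G x)
    have hq := dn_sq hk (G x)
    have ho := h.ode (G x)
    simp only [Function.comp]
    rw [div_mul_cancel₀ _ hp.ne']
    linear_combination ho + χ2 (G x) * hq
  have e1 : deriv (fun x => χ (G x)) = fun x => χ1 (G x) * dn k (G x) :=
    funext fun x => (b1 x).deriv
  have e2 : deriv (fun x => χ1 (G x) * dn k (G x)) =
      fun x => (MM ν k * sin (G x) ^ 2 - lam) * χ (G x) := funext fun x => (b2 x).deriv
  have cχ : Continuous χ := continuous_iff_continuousAt.2 fun t => (h.d1 t).continuousAt
  refine ⟨?_, ?_, ?_, ?_⟩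
  · intro h0
    obtain ⟨t, ht⟩ := hne
    apply ht
    have := congrFun h0 (FF k t)
    simpa [hGF] using this
  · have hh : ContDiff ℝ (0 + 1) (deriv fun x => χ (G x)) := by
      rw [e1]
      refine contDiff_succ_iff_deriv.2 ⟨fun x => (b2 x).differentiableAt, by simp, ?_⟩
      rw [e2, contDiff_zero]
      fun_prop
    have : ContDiff ℝ ((0 + 1) + 1) (fun x => χ (G x)) :=
      contDiff_succ_iff_deriv.2 ⟨fun x => (b1 x).differentiableAt, by simp, hh⟩
    norm_num at this
    exact this
  · intro x
    rw [e1, e2]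
    simp only [lamePot, hsG, MM]
    ring
  · intro x
    simp only [hGp, h.per, one_mul]

end LameAux

/-- Let `m = 2ν`. If `λ` belongs to the `2K`-periodic spectrum
of the Lamé operator `L_m = -d²/dx² + m(m+1)k² sn²(x,k)` and has multiplicity
`1`, then `λ ∈ S_ν = S_{ν,1} ∪ S_{ν,2}`, i.e. `det K_{ν,1}(λ) = 0` or
`det K_{ν,2}(λ) = 0`. -/
theorem simple_periodic_eigenvalue_mem_S
    (ν : ℕ) (k : ℝ) (hk : k ∈ Set.Ioo (0:ℝ) 1)
    (sn : ℝ → ℝ) (hsn : IsJacobiSn k sn) (lam : ℝ)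
    (hev : IsPeriodicEV (lamePot (2 * ν) k sn) (2 * ellK k) lam)
    (hsimple : ¬ IsDoublePeriodicEV (lamePot (2 * ν) k sn) (2 * ellK k) lam) :
    (matK1 ν k lam).det = 0 ∨ (matK2 ν k lam).det = 0 := by
  by_contra! hdet
  obtain ⟨h1, h2⟩ := hdet
  obtain ⟨G, hGF, hFG, hG, hGp⟩ := LameAux.exists_am hk
  have hG0 : G 0 = 0 := by
    have := hGF 0
    rwa [LameAux.FF_zero] at this
  have hsG := LameAux.sn_eq hk hsn G hG0 hG
  obtain ⟨ψ, hψ⟩ := hev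
  obtain ⟨φ1, φ2, hφ⟩ := LameAux.ince_of_lame hk (fun t => by rw [hsG, hGF]) hψ
  have hne : ∃ t, ψ (LameAux.FF k t) ≠ 0 := by
    by_contra! h0
    apply hψ.1
    funext x
    rw [← hFG x, h0]; rfl
  obtain ⟨⟨χe, _, _, he, hee, hene⟩, ⟨χo, _, _, ho, hoo, hone⟩⟩ :=
    LameAux.ince_both hk hφ hne h1 h2
  apply hsimple
  refine ⟨fun x => χe (G x), fun x => χo (G x), ?_,
    LameAux.lame_of_ince hk hGF hG hGp hsG he hene,
    LameAux.lame_of_ince hk hGF hG hGp hsG ho hone⟩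
  rw [LinearIndependent.pair_iff]
  intro s r hsr
  have h : ∀ t, s * χe t + r * χo t = 0 := by
    intro t
    have := congrFun hsr (LameAux.FF k t)
    simpa [hGF] using this
  obtain ⟨t, ht⟩ := hene
  obtain ⟨t', ht'⟩ := hone
  constructor
  · have a := h t
    have b := h (-t)
    rw [hee, hoo] at b
    have : s * χe t = 0 := by linarith
    exact (mul_eq_zero.1 this).resolve_right ht
  · have a := h t'
    have b := h (-t')
    rw [hee, hoo] at b
    have : r * χo t' = 0 := by linarith
    exact (mul_eq_zero.1 this).resolve_right ht'
end
end

section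
/- Let m = 2ν with ν a nonnegative integer. If λ belongs to the 2K-antiperiodic spectrum of the Lamé operator L_m = -d²/dx² + m(m+1)k² sn²(x,k) and has multiplicity 1, then λ ∈ S*_ν = S*_{ν,1} ∪ S*_{ν,2}, where S*_{ν,1} and S*_{ν,2} are the zero sets of the determinants of the ν×ν tridiagonal matrices K*_{ν,1} and K*_{ν,2} defined below. -/
open Set Filter

noncomputable section

/-- The exponential `e^{int}`. -/
def ee (n : ℤ) (t : ℝ) : ℂ := Complex.exp (Complex.I * n * t)

lemma ee_add (m n : ℤ) (t : ℝ) : ee (m + n) t = ee m t * ee n t := by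
  unfold ee; rw [← Complex.exp_add]; congr 1; push_cast; ring

lemma ee_zero (t : ℝ) : ee 0 t = 1 := by simp [ee]

lemma ee_norm (n : ℤ) (t : ℝ) : ‖ee n t‖ = 1 := by
  unfold ee
  rw [show Complex.I * n * t = ((n * t : ℝ) : ℂ) * Complex.I by push_cast; ring]
  exact Complex.norm_exp_ofReal_mul_I _

lemma ee_conj (n : ℤ) (t : ℝ) : (starRingEnd ℂ) (ee n t) = ee (-n) t := by
  unfold ee; rw [← Complex.exp_conj]; congr 1; simp

lemma ee_hasDerivAt (n : ℤ) (t : ℝ) : HasDerivAt (ee n) (Complex.I * n * ee n t) t := by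
  have h : HasDerivAt (fun t : ℝ => Complex.I * n * (t : ℂ)) (Complex.I * n * 1) t :=
    (Complex.ofRealCLM.hasDerivAt (x := t)).const_mul _
  have h3 := h.cexp
  have h4 : Complex.I * n * ee n t = Complex.exp (Complex.I * n * t) * (Complex.I * n * 1) := by
    unfold ee; ring
  rw [h4]; exact h3

lemma ee_continuous (n : ℤ) : Continuous (ee n) := by unfold ee; fun_prop

lemma ee_two_pi (n : ℤ) : ee n (2 * Real.pi) = 1 := by
  unfold ee
  rw [Complex.exp_eq_one_iff]; exact ⟨n, by push_cast; ring⟩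

lemma ee_at_zero (n : ℤ) : ee n 0 = 1 := by simp [ee]

lemma ee_add_pi (j : ℤ) (t : ℝ) : ee (2 * j + 1) (t + Real.pi) = - ee (2 * j + 1) t := by
  unfold ee
  rw [show Complex.I * ((2 * j + 1 : ℤ) : ℂ) * ((t + Real.pi : ℝ) : ℂ)
    = Complex.I * ((2 * j + 1 : ℤ) : ℂ) * t + j * (2 * Real.pi * Complex.I) + Real.pi * Complex.I by
      push_cast; ring]
  rw [Complex.exp_add, Complex.exp_add, Complex.exp_int_mul_two_pi_mul_I, Complex.exp_pi_mul_I]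
  ring

lemma ee_even_add_pi (j : ℤ) (t : ℝ) : ee (2 * j) (t + Real.pi) = ee (2 * j) t := by
  unfold ee
  rw [show Complex.I * ((2 * j : ℤ) : ℂ) * ((t + Real.pi : ℝ) : ℂ)
    = Complex.I * ((2 * j : ℤ) : ℂ) * t + j * (2 * Real.pi * Complex.I) by
      push_cast; ring]
  rw [Complex.exp_add, Complex.exp_int_mul_two_pi_mul_I]
  ring

/-- Fourier coefficient (unnormalised). -/
def fc (f : ℝ → ℂ) (n : ℤ) : ℂ := ∫ t in (0:ℝ)..(2 * Real.pi), f t * ee (-n) t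

lemma integral_ee (n : ℤ) : (∫ t in (0:ℝ)..(2 * Real.pi), ee n t) = if n = 0 then 2 * Real.pi else 0 := by
  split_ifs with h
  · subst h; simp [ee_zero]
  · have hn : (Complex.I * n : ℂ) ≠ 0 := by simp [h]
    have : ∀ t ∈ uIcc (0:ℝ) (2 * Real.pi), HasDerivAt (fun t => (Complex.I * n : ℂ)⁻¹ * ee n t) (ee n t) t := by
      intro t _
      have := (ee_hasDerivAt n t).const_mul ((Complex.I * n : ℂ)⁻¹)
      rwa [← mul_assoc, inv_mul_cancel₀ hn, one_mul] at this
    rw [intervalIntegral.integral_eq_sub_of_hasDerivAt this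
      ((ee_continuous n).intervalIntegrable _ _), ee_two_pi, ee_at_zero, sub_self]
    simp

lemma fc_deriv {f f' : ℝ → ℂ} (hf : ∀ t, HasDerivAt f (f' t) t) (hf' : Continuous f')
    (hp : f (2 * Real.pi) = f 0) (n : ℤ) : fc f' n = Complex.I * n * fc f n := by
  have hfc : Continuous f := continuous_iff_continuousAt.2 fun t => (hf t).continuousAt
  have key : ∀ t ∈ uIcc (0:ℝ) (2 * Real.pi), HasDerivAt (fun t => f t * ee (-n) t)
      (f' t * ee (-n) t + f t * (Complex.I * (-n : ℤ) * ee (-n) t)) t := fun t _ =>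
    (hf t).mul (ee_hasDerivAt (-n) t)
  have he := ee_continuous (-n)
  have := intervalIntegral.integral_eq_sub_of_hasDerivAt key
    (Continuous.intervalIntegrable (by fun_prop) _ _)
  rw [intervalIntegral.integral_add (Continuous.intervalIntegrable (by fun_prop) _ _)
    (Continuous.intervalIntegrable (by fun_prop) _ _), ee_two_pi, ee_at_zero, hp, sub_self] at this
  have h2 : (∫ t in (0:ℝ)..(2 * Real.pi), f t * (Complex.I * (-n : ℤ) * ee (-n) t))
      = - (Complex.I * n * fc f n) := by
    unfold fc
    rw [← intervalIntegral.integral_const_mul, ← intervalIntegral.integral_neg]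
    congr 1; ext t; push_cast; ring
  rw [h2] at this
  unfold fc at *
  linear_combination this

lemma fc_bound (f : ℝ → ℂ) : ∃ C, ∀ n, ‖fc f n‖ ≤ C := by
  refine ⟨|∫ t in (0:ℝ)..(2 * Real.pi), ‖f t‖|, fun n => ?_⟩
  unfold fc
  refine (intervalIntegral.norm_integral_le_abs_integral_norm).trans (le_of_eq ?_)
  simp [ee_norm]

lemma fc_conj (y : ℝ → ℝ) (n : ℤ) : (starRingEnd ℂ) (fc (fun t => (y t : ℂ)) n)
    = fc (fun t => (y t : ℂ)) (-n) := by
  unfold fc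
  rw [← intervalIntegral.intervalIntegral_conj]
  simp [ee_conj]

lemma fc_shift (f : ℝ → ℂ) (m n : ℤ) : fc (fun t => ee m t * f t) n = fc f (n - m) := by
  unfold fc
  congr 1; ext t
  rw [show -(n - m) = m + -n by ring, ee_add]; ring

lemma fc_even {f : ℝ → ℂ} (hf : Continuous f) (hanti : ∀ t, f (t + Real.pi) = - f t) (j : ℤ) :
    fc f (2 * j) = 0 := by
  unfold fc
  have he := ee_continuous (-(2 * j))
  have hc : Continuous fun t => f t * ee (-(2 * j)) t := hf.mul (ee_continuous _)
  rw [← intervalIntegral.integral_add_adjacent_intervals (b := Real.pi)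
    (hc.intervalIntegrable _ _) (hc.intervalIntegrable _ _)]
  have := intervalIntegral.integral_comp_add_right (a := 0) (b := Real.pi)
    (fun t => f t * ee (-(2 * j)) t) Real.pi
  rw [zero_add, ← two_mul] at this
  rw [← this, ← intervalIntegral.integral_add (hc.intervalIntegrable _ _)
    (Continuous.intervalIntegrable (by fun_prop) _ _)]
  have h0 : ∀ t, f t * ee (-(2 * j)) t + f (t + Real.pi) * ee (-(2 * j)) (t + Real.pi) = 0 := by
    intro t
    rw [hanti, show -(2 * j) = 2 * (-j) by ring, ee_even_add_pi]; ring
  simp [h0]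

lemma fc_complete {f : ℝ → ℂ} (hf : Continuous f) (hp : Function.Periodic f (2 * Real.pi))
    (h0 : ∀ n, fc f n = 0) : f = 0 := by
  have : Fact (0 < 2 * Real.pi) := ⟨Real.two_pi_pos⟩
  let g : C(AddCircle (2 * Real.pi), ℂ) := ⟨hp.lift, by
    exact continuous_quot_lift _ hf⟩
  have hg : ∀ n, fourierCoeff g n = 0 := by
    intro n
    rw [fourierCoeff_eq_intervalIntegral _ _ 0]
    have := h0 n
    unfold fc at this
    rw [zero_add]
    convert smul_zero _
    rw [← this]
    congr 1; ext t
    rw [fourier_coe_apply, smul_eq_mul, mul_comm]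
    congr 1
    unfold ee
    congr 1
    have : (Real.pi : ℂ) ≠ 0 := by exact_mod_cast Real.pi_ne_zero
    push_cast
    field_simp
  have hs : Summable (fourierCoeff g) := by
    rw [show fourierCoeff g = fun _ => (0:ℂ) from funext hg]; exact summable_zero
  ext t
  have := has_pointwise_sum_fourier_series_of_summable hs (t : AddCircle (2 * Real.pi))
  simp only [hg, zero_smul] at this
  exact this.unique hasSum_zero

lemma fc_tsum {B : ℤ → ℂ} (hB : Summable fun j => ‖B j‖) (l : ℤ) :
    fc (fun t => ∑' j, B j * ee (2 * j + 1) t) (2 * l + 1) = 2 * Real.pi * B l := by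
  unfold fc
  have h := intervalIntegral.hasSum_integral_of_dominated_convergence (μ := MeasureTheory.volume)
    (a := 0) (b := 2 * Real.pi)
    (F := fun (j : ℤ) t => B j * ee (2 * j + 1) t * ee (-(2 * l + 1)) t)
    (f := fun t => (∑' j, B j * ee (2 * j + 1) t) * ee (-(2 * l + 1)) t)
    (fun j _ => ‖B j‖)
    (fun j => (Continuous.aestronglyMeasurable (by
      have := ee_continuous (2 * j + 1); have := ee_continuous (-(2 * l + 1)); fun_prop)))
    (fun j => by simp [ee_norm]) (by simp [hB]) (by simp)
    (by
      refine Filter.Eventually.of_forall fun t _ => ?_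
      refine HasSum.mul_right _ (Summable.hasSum ?_)
      exact Summable.of_norm (by simpa [ee_norm] using hB))
  have h2 : ∀ j, (∫ t in (0:ℝ)..(2 * Real.pi), B j * ee (2 * j + 1) t * ee (-(2 * l + 1)) t)
      = if j = l then 2 * Real.pi * B l else 0 := by
    intro j
    have : ∀ t, B j * ee (2 * j + 1) t * ee (-(2 * l + 1)) t = B j * ee (2 * (j - l)) t := by
      intro t
      rw [mul_assoc, ← ee_add]; congr 2; ring
    simp_rw [this]
    rw [intervalIntegral.integral_const_mul, integral_ee]
    by_cases hjl : j = l
    · subst hjl; simp; ring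
    · have : 2 * (j - l) ≠ 0 := by omega
      rw [if_neg this, if_neg hjl]; simp
  simp_rw [h2] at h
  exact h.unique (hasSum_ite_eq l _)
lemma sin_sq_ee (t : ℝ) : (Real.sin t : ℂ) ^ 2 = 1 / 2 - (ee 2 t + ee (-2) t) / 4 := by
  have h : ∀ n : ℤ, ee n t = Complex.exp (t * Complex.I) ^ n := by
    intro n; rw [← Complex.exp_int_mul]; unfold ee; congr 1; ring
  have hne := Complex.exp_ne_zero (t * Complex.I)
  rw [Complex.ofReal_sin, Complex.sin, h, h, neg_mul, Complex.exp_neg]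
  generalize Complex.exp (t * Complex.I) = w at *
  have hI := Complex.I_sq
  rw [show (-2:ℤ) = -(2:ℕ) by norm_num, zpow_neg, zpow_natCast, show (2:ℤ) = (2:ℕ) by norm_num, zpow_natCast]
  field_simp
  ring_nf
  rw [hI]; ring

lemma sin_cos_ee (t : ℝ) : (Real.sin t : ℂ) * Real.cos t
    = -Complex.I * (ee 2 t - ee (-2) t) / 4 := by
  have h : ∀ n : ℤ, ee n t = Complex.exp (t * Complex.I) ^ n := by
    intro n; rw [← Complex.exp_int_mul]; unfold ee; congr 1; ring
  have hne := Complex.exp_ne_zero (t * Complex.I)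
  rw [Complex.ofReal_sin, Complex.ofReal_cos, Complex.sin, Complex.cos, h, h, neg_mul, Complex.exp_neg]
  generalize Complex.exp (t * Complex.I) = w at *
  rw [show (-2:ℤ) = -(2:ℕ) by norm_num, zpow_neg, zpow_natCast, show (2:ℤ) = (2:ℕ) by norm_num, zpow_natCast]
  field_simp
  ring

lemma fc_add {f g : ℝ → ℂ} (hf : Continuous f) (hg : Continuous g) (n : ℤ) :
    fc (fun t => f t + g t) n = fc f n + fc g n := by
  unfold fc
  have he := ee_continuous (-n)
  rw [← intervalIntegral.integral_add (Continuous.intervalIntegrable (by fun_prop) _ _)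
    (Continuous.intervalIntegrable (by fun_prop) _ _)]
  congr 1; ext t; ring

lemma fc_const_mul (a : ℂ) (f : ℝ → ℂ) (n : ℤ) :
    fc (fun t => a * f t) n = a * fc f n := by
  unfold fc
  rw [← intervalIntegral.integral_const_mul]
  congr 1; ext t; ring

/-- The three-term recurrence for the Fourier coefficients of a solution of the Ince equation. -/
lemma fc_rec {f f1 f2 : ℝ → ℂ} (hf : ∀ t, HasDerivAt f (f1 t) t) (hf1 : ∀ t, HasDerivAt f1 (f2 t) t)
    (hf2 : Continuous f2) (hp : f (2 * Real.pi) = f 0) (hp1 : f1 (2 * Real.pi) = f1 0)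
    (k lam M : ℝ)
    (hode : ∀ t, (1 - (k:ℂ) ^ 2 * (Real.sin t : ℂ) ^ 2) * f2 t
      - (k:ℂ) ^ 2 * ((Real.sin t : ℂ) * Real.cos t) * f1 t
      + (lam - M * (k:ℂ) ^ 2 * (Real.sin t : ℂ) ^ 2) * f t = 0) (n : ℤ) :
    (k:ℂ) ^ 2 / 4 * (M - (n - 2) ^ 2 - (n - 2)) * fc f (n - 2)
      + (lam - M * (k:ℂ) ^ 2 / 2 - (1 - (k:ℂ) ^ 2 / 2) * n ^ 2) * fc f n
      + (k:ℂ) ^ 2 / 4 * (M - (n + 2) ^ 2 + (n + 2)) * fc f (n + 2) = 0 := by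
  have c0 : Continuous f := continuous_iff_continuousAt.2 fun t => (hf t).continuousAt
  have c1 : Continuous f1 := continuous_iff_continuousAt.2 fun t => (hf1 t).continuousAt
  have e2 := ee_continuous 2
  have e2' := ee_continuous (-2)
  let g : ℝ → ℂ := fun t => (1 - (k:ℂ) ^ 2 / 2) * f2 t + (lam - M * (k:ℂ) ^ 2 / 2) * f t
  let gp : ℝ → ℂ := fun t => ((k:ℂ) ^ 2 / 4) * f2 t
    + ((k:ℂ) ^ 2 * Complex.I / 4 * f1 t + M * (k:ℂ) ^ 2 / 4 * f t)
  let gm : ℝ → ℂ := fun t => ((k:ℂ) ^ 2 / 4) * f2 t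
    + (-(k:ℂ) ^ 2 * Complex.I / 4 * f1 t + M * (k:ℂ) ^ 2 / 4 * f t)
  have hz : (fun t => g t + (ee 2 t * gp t + ee (-2) t * gm t)) = fun _ => 0 := by
    funext t
    rw [← hode t, sin_sq_ee, sin_cos_ee]
    simp only [g, gp, gm]
    ring
  have h0 : fc (fun t => g t + (ee 2 t * gp t + ee (-2) t * gm t)) n = 0 := by
    rw [hz]; simp [fc]
  have d1 : ∀ n, fc f1 n = Complex.I * n * fc f n := fc_deriv hf c1 hp
  have d2 : ∀ n, fc f2 n = Complex.I * n * fc f1 n := fc_deriv hf1 hf2 hp1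
  have cg : Continuous g := by fun_prop
  have cgp : Continuous fun t => ee 2 t * gp t := by fun_prop
  have cgm : Continuous fun t => ee (-2) t * gm t := by fun_prop
  have cs : Continuous fun t => ee 2 t * gp t + ee (-2) t * gm t := by fun_prop
  rw [fc_add cg cs, fc_add cgp cgm, fc_shift, fc_shift] at h0
  simp only [g, gp, gm] at h0
  rw [fc_add (by fun_prop) (by fun_prop), fc_add (by fun_prop) (by fun_prop),
    fc_add (by fun_prop) (by fun_prop), fc_add (by fun_prop) (by fun_prop),
    fc_add (by fun_prop) (by fun_prop)] at h0
  simp only [fc_const_mul, d1, d2] at h0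
  rw [show n - -2 = n + 2 by ring] at h0
  push_cast at h0
  linear_combination (norm := skip) h0
  ring_nf
  simp only [Complex.I_sq]
  ring

/-- Termwise differentiation and the Ince equation for a Fourier series whose coefficients
satisfy the recurrence. -/
lemma series_ode {B : ℤ → ℂ} (hB : Summable fun j : ℤ => ‖B j‖ * (2 * (j:ℝ) + 1) ^ 2)
    (k lam M : ℝ)
    (hrec : ∀ j : ℤ, (k:ℂ) ^ 2 / 4 * (M - (2 * j - 1) ^ 2 - (2 * j - 1)) * B (j - 1)
      + (lam - M * (k:ℂ) ^ 2 / 2 - (1 - (k:ℂ) ^ 2 / 2) * (2 * j + 1) ^ 2) * B j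
      + (k:ℂ) ^ 2 / 4 * (M - (2 * j + 3) ^ 2 + (2 * j + 3)) * B (j + 1) = 0) :
    ∃ u1 u2 : ℝ → ℂ, (∀ t, HasDerivAt (fun t => ∑' j, B j * ee (2 * j + 1) t) (u1 t) t) ∧
      (∀ t, HasDerivAt u1 (u2 t) t) ∧
      ∀ t, (1 - (k:ℂ) ^ 2 * (Real.sin t : ℂ) ^ 2) * u2 t
      - (k:ℂ) ^ 2 * ((Real.sin t : ℂ) * Real.cos t) * u1 t
      + (lam - M * (k:ℂ) ^ 2 * (Real.sin t : ℂ) ^ 2) * (∑' j, B j * ee (2 * j + 1) t) = 0 := by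
  have hJ : ∀ j : ℤ, 1 ≤ |2 * (j:ℝ) + 1| := by
    intro j
    have : (1:ℤ) ≤ |2 * j + 1| := by
      rw [← Int.cast_id (n := |2 * j + 1|)]
      exact Int.one_le_abs (by omega)
    exact_mod_cast this
  have s1 : Summable fun j : ℤ => ‖B j‖ * |2 * (j:ℝ) + 1| := by
    refine hB.of_nonneg_of_le (fun j => by positivity) (fun j => ?_)
    have := hJ j
    rw [← sq_abs (2 * (j:ℝ) + 1)]
    gcongr; nlinarith
  have s0 : Summable fun j : ℤ => ‖B j‖ := by
    refine s1.of_nonneg_of_le (fun j => by positivity) (fun j => ?_)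
    have := hJ j
    have := norm_nonneg (B j)
    nlinarith
  have n1 : ∀ j : ℤ, ‖(2 * (j:ℂ) + 1)‖ = |2 * (j:ℝ) + 1| := by
    intro j
    rw [← Real.norm_eq_abs, ← Complex.norm_real]; push_cast; rfl
  let T0 : ℤ → ℝ → ℂ := fun j t => B j * ee (2 * j + 1) t
  let T1 : ℤ → ℝ → ℂ := fun j t => B j * (Complex.I * (2 * j + 1)) * ee (2 * j + 1) t
  let T2 : ℤ → ℝ → ℂ := fun j t => B j * (Complex.I * (2 * j + 1)) ^ 2 * ee (2 * j + 1) t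
  have nT0 : ∀ j t, ‖T0 j t‖ = ‖B j‖ := by intro j t; simp [T0, ee_norm]
  have nT1 : ∀ j t, ‖T1 j t‖ = ‖B j‖ * |2 * (j:ℝ) + 1| := by
    intro j t; simp [T1, ee_norm, n1]
  have nT2 : ∀ j t, ‖T2 j t‖ = ‖B j‖ * (2 * (j:ℝ) + 1) ^ 2 := by
    intro j t; simp [T2, ee_norm, n1]
  have S0 : ∀ t, Summable fun j => T0 j t := fun t => Summable.of_norm (by simpa [nT0] using s0)
  have S1 : ∀ t, Summable fun j => T1 j t := fun t => Summable.of_norm (by simpa [nT1] using s1)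
  have S2 : ∀ t, Summable fun j => T2 j t := fun t => Summable.of_norm (by simpa [nT2] using hB)
  have D0 : ∀ j t, HasDerivAt (T0 j) (T1 j t) t := by
    intro j t
    have h := (ee_hasDerivAt (2 * j + 1) t).const_mul (B j)
    have h2 : T1 j t = B j * (Complex.I * ((2 * j + 1 : ℤ) : ℂ) * ee (2 * j + 1) t) := by
      simp only [T1]; push_cast; ring
    rw [h2]; exact h
  have D1 : ∀ j t, HasDerivAt (T1 j) (T2 j t) t := by
    intro j t
    have h := (ee_hasDerivAt (2 * j + 1) t).const_mul (B j * (Complex.I * (2 * j + 1)))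
    have h2 : T2 j t = B j * (Complex.I * (2 * j + 1)) * (Complex.I * ((2 * j + 1 : ℤ) : ℂ) * ee (2 * j + 1) t) := by
      simp only [T2]; push_cast; ring
    rw [h2]; exact h
  refine ⟨fun t => ∑' j, T1 j t, fun t => ∑' j, T2 j t, fun t => ?_, fun t => ?_, fun t => ?_⟩
  · exact hasDerivAt_tsum s1 D0 (fun j t => (nT1 j t).le) (S0 0) t
  · exact hasDerivAt_tsum hB D1 (fun j t => (nT2 j t).le) (S1 0) t
  · change _ + _ * (∑' j, T0 j t) = 0
    rw [sin_sq_ee, sin_cos_ee]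
    -- the three diagonals
    let X : ℤ → ℂ := fun j =>
      (lam - M * (k:ℂ) ^ 2 / 2 - (1 - (k:ℂ) ^ 2 / 2) * (2 * j + 1) ^ 2) * B j * ee (2 * j + 1) t
    let Y : ℤ → ℂ := fun j =>
      (k:ℂ) ^ 2 / 4 * (M - (2 * j - 1) ^ 2 - (2 * j - 1)) * B (j - 1) * ee (2 * j + 1) t
    let Z : ℤ → ℂ := fun j =>
      (k:ℂ) ^ 2 / 4 * (M - (2 * j + 3) ^ 2 + (2 * j + 3)) * B (j + 1) * ee (2 * j + 1) t
    have hI := Complex.I_sq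
    have hX : ∀ j, X j = (lam - M * (k:ℂ) ^ 2 / 2) * T0 j t + (1 - (k:ℂ) ^ 2 / 2) * T2 j t := by
      intro j; simp only [X, T0, T2, mul_pow, hI]; ring
    have hY : ∀ j, Y (j + 1) = ee 2 t * ((k:ℂ) ^ 2 / 4 * M * T0 j t
        + (k:ℂ) ^ 2 / 4 * Complex.I * T1 j t + (k:ℂ) ^ 2 / 4 * T2 j t) := by
      intro j
      simp only [Y, T0, T1, T2]
      rw [show 2 * (j + 1) + 1 = 2 + (2 * j + 1) by ring, ee_add, add_sub_cancel_right]
      push_cast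
      linear_combination (-(k:ℂ) ^ 2 / 4 * B j * ee 2 t * ee (2 * j + 1) t * ((2 * j + 1) + (2 * j + 1) ^ 2)) * hI
    have hZ : ∀ j, Z (j - 1) = ee (-2) t * ((k:ℂ) ^ 2 / 4 * M * T0 j t
        - (k:ℂ) ^ 2 / 4 * Complex.I * T1 j t + (k:ℂ) ^ 2 / 4 * T2 j t) := by
      intro j
      simp only [Z, T0, T1, T2]
      rw [show 2 * (j - 1) + 1 = -2 + (2 * j + 1) by ring, ee_add, sub_add_cancel]
      push_cast
      linear_combination (-(k:ℂ) ^ 2 / 4 * B j * ee (-2) t * ee (2 * j + 1) t * (-(2 * j + 1) + (2 * j + 1) ^ 2)) * hI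
    have H0 := (S0 t).hasSum
    have H1 := (S1 t).hasSum
    have H2 := (S2 t).hasSum
    have HX : HasSum X ((lam - M * (k:ℂ) ^ 2 / 2) * ∑' j, T0 j t + (1 - (k:ℂ) ^ 2 / 2) * ∑' j, T2 j t) := by
      rw [show X = _ from funext hX]
      exact (H0.mul_left _).add (H2.mul_left _)
    have HY : HasSum (fun j => Y (j + 1)) (ee 2 t * ((k:ℂ) ^ 2 / 4 * M * ∑' j, T0 j t
        + (k:ℂ) ^ 2 / 4 * Complex.I * ∑' j, T1 j t + (k:ℂ) ^ 2 / 4 * ∑' j, T2 j t)) := by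
      simp_rw [hY]
      exact (((H0.mul_left _).add (H1.mul_left _)).add (H2.mul_left _)).mul_left _
    have HZ : HasSum (fun j => Z (j - 1)) (ee (-2) t * ((k:ℂ) ^ 2 / 4 * M * ∑' j, T0 j t
        - (k:ℂ) ^ 2 / 4 * Complex.I * ∑' j, T1 j t + (k:ℂ) ^ 2 / 4 * ∑' j, T2 j t)) := by
      simp_rw [hZ]
      exact (((H0.mul_left _).sub (H1.mul_left _)).add (H2.mul_left _)).mul_left _
    have HY' := (Equiv.hasSum_iff (Equiv.addRight (1:ℤ)) (f := Y)).1 HY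
    have HZ' := (Equiv.hasSum_iff (Equiv.subRight (1:ℤ)) (f := Z)).1 HZ
    have Htot := (HX.add HY').add HZ'
    have hz : ∀ j, X j + Y j + Z j = 0 := by
      intro j
      simp only [X, Y, Z]
      linear_combination ee (2 * j + 1) t * hrec j
    simp_rw [hz] at Htot
    have := Htot.unique hasSum_zero
    linear_combination this
/-- `Δ(t) = √(1 - k² sin² t)`. -/
def dl (k t : ℝ) : ℝ := Real.sqrt (1 - k ^ 2 * Real.sin t ^ 2)

lemma dl_arg_pos {k : ℝ} (hk : k ∈ Set.Ioo (0:ℝ) 1) (t : ℝ) : 0 < 1 - k ^ 2 * Real.sin t ^ 2 := by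
  have h1 := Real.sin_sq_le_one t
  have h2 : k ^ 2 < 1 := by nlinarith [hk.1, hk.2]
  nlinarith [sq_nonneg k, sq_nonneg (Real.sin t)]

lemma dl_pos {k : ℝ} (hk : k ∈ Set.Ioo (0:ℝ) 1) (t : ℝ) : 0 < dl k t :=
  Real.sqrt_pos.2 (dl_arg_pos hk t)

lemma dl_sq {k : ℝ} (hk : k ∈ Set.Ioo (0:ℝ) 1) (t : ℝ) : dl k t ^ 2 = 1 - k ^ 2 * Real.sin t ^ 2 :=
  Real.sq_sqrt (dl_arg_pos hk t).le

lemma dl_le_one {k : ℝ} (t : ℝ) : dl k t ≤ 1 := by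
  unfold dl
  refine Real.sqrt_le_iff.2 ⟨zero_le_one, ?_⟩
  nlinarith [mul_nonneg (sq_nonneg k) (sq_nonneg (Real.sin t))]

lemma dl_hasDerivAt {k : ℝ} (hk : k ∈ Set.Ioo (0:ℝ) 1) (t : ℝ) :
    HasDerivAt (dl k) (-(k ^ 2 * (Real.sin t * Real.cos t)) / dl k t) t := by
  have h := (((Real.hasDerivAt_sin t).pow 2).const_mul (k ^ 2)).const_sub 1
  have h2 := h.sqrt (dl_arg_pos hk t).ne'
  have h3 := (dl_pos hk t).ne'
  have e : -(k ^ 2 * (Real.sin t * Real.cos t)) / dl k t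
    = -(k ^ 2 * ((2:ℕ) * Real.sin t ^ (2 - 1) * Real.cos t)) / (2 * Real.sqrt (1 - k ^ 2 * Real.sin t ^ 2)) := by
    change _ = _ / (2 * dl k t)
    field_simp
    push_cast
    ring
  rw [e]; exact h2

lemma dl_continuous (k : ℝ) : Continuous (dl k) := by unfold dl; fun_prop

lemma dl_contDiff {k : ℝ} (hk : k ∈ Set.Ioo (0:ℝ) 1) (n : WithTop ℕ∞) : ContDiff ℝ n (dl k) := by
  unfold dl
  refine ContDiff.sqrt ?_ (fun t => (dl_arg_pos hk t).ne')
  have : ContDiff ℝ n Real.sin := Real.contDiff_sin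
  fun_prop

lemma dl_periodic (k : ℝ) : Function.Periodic (dl k) Real.pi := by
  intro t; simp [dl, Real.sin_add_pi]

/-- The amplitude function and its inverse. -/
lemma exists_am {k : ℝ} (hk : k ∈ Set.Ioo (0:ℝ) 1) : ∃ F G : ℝ → ℝ,
    (∀ t, HasDerivAt F (1 / dl k t) t) ∧ F 0 = 0 ∧ (∀ t, F (t + Real.pi) = F t + 2 * ellK k) ∧
    (∀ t, G (F t) = t) ∧ (∀ x, F (G x) = x) ∧ (∀ x, HasDerivAt G (dl k (G x)) x) := by
  have hc : Continuous fun t => 1 / dl k t :=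
    continuous_const.div (dl_continuous k) fun t => (dl_pos hk t).ne'
  let F : ℝ → ℝ := fun t => ∫ s in (0:ℝ)..t, 1 / dl k s
  have hF : ∀ t, HasDerivAt F (1 / dl k t) t := fun t => hc.integral_hasStrictDerivAt 0 t |>.hasDerivAt
  have hF0 : F 0 = 0 := by simp [F]
  have hii : ∀ a b, IntervalIntegrable (fun t => 1 / dl k t) MeasureTheory.volume a b :=
    fun a b => hc.intervalIntegrable a b
  have hper : Function.Periodic (fun t => 1 / dl k t) Real.pi := fun t => by
    simp only [dl_periodic k t]
  have hK : (∫ s in (0:ℝ)..Real.pi, 1 / dl k s) = 2 * ellK k := by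
    rw [← intervalIntegral.integral_add_adjacent_intervals (hii 0 (Real.pi / 2)) (hii (Real.pi / 2) Real.pi)]
    have h := intervalIntegral.integral_comp_sub_left (a := 0) (b := Real.pi / 2)
      (fun s => 1 / dl k s) Real.pi
    rw [sub_zero, show Real.pi - Real.pi / 2 = Real.pi / 2 by ring] at h
    rw [← h]
    have : ∀ s, dl k (Real.pi - s) = dl k s := by intro s; simp [dl, Real.sin_pi_sub]
    simp_rw [this]
    unfold ellK dl
    ring
  have hFpi : ∀ t, F (t + Real.pi) = F t + 2 * ellK k := by
    intro t
    simp only [F]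
    rw [← intervalIntegral.integral_add_adjacent_intervals (hii 0 t) (hii t (t + Real.pi)),
      hper.intervalIntegral_add_eq t 0, zero_add, hK]
  have hpos : ∀ t, 0 < 1 / dl k t := fun t => one_div_pos.2 (dl_pos hk t)
  have hmono : StrictMono F := strictMono_of_hasDerivAt_pos hF hpos
  have hFc : Continuous F := continuous_iff_continuousAt.2 fun t => (hF t).continuousAt
  have hmono2 : Monotone fun t => F t - t := by
    refine monotone_of_deriv_nonneg (fun t => ((hF t).sub (hasDerivAt_id t)).differentiableAt) fun t => ?_
    have h5 : HasDerivAt (fun t => F t - t) (1 / dl k t - 1) t := (hF t).sub (hasDerivAt_id t)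
    rw [h5.deriv, sub_nonneg, le_div_iff₀ (dl_pos hk t), one_mul]
    exact dl_le_one t
  have hsurj : Function.Surjective F := by
    refine hFc.surjective ?_ ?_
    · refine tendsto_atTop_mono' _ ?_ tendsto_id
      filter_upwards [eventually_ge_atTop 0] with t ht
      have := hmono2 ht
      simp only [hF0] at this
      simp only [id]; linarith
    · refine tendsto_atBot_mono' _ ?_ tendsto_id
      filter_upwards [eventually_le_atBot 0] with t ht
      have := hmono2 ht
      simp only [hF0] at this
      simp only [id]; linarith
  let e := hmono.orderIsoOfSurjective F hsurj
  have he : ∀ t, e t = F t := fun t => rfl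
  have h1 : ∀ t, e.symm (F t) = t := fun t => e.symm_apply_apply t
  have h2 : ∀ x, F (e.symm x) = x := fun x => e.apply_symm_apply x
  refine ⟨F, e.symm, hF, hF0, hFpi, h1, h2, fun x => ?_⟩
  have h3 := HasDerivAt.of_local_left_inverse (e.symm.continuous.continuousAt (x := x)) (hF (e.symm x))
    (hpos _).ne' (Eventually.of_forall h2)
  rwa [one_div, inv_inv] at h3

lemma sn_am {k : ℝ} (hk : k ∈ Set.Ioo (0:ℝ) 1) {sn : ℝ → ℝ} (hsn : IsJacobiSn k sn)
    {F : ℝ → ℝ} (hF : ∀ t, HasDerivAt F (1 / dl k t) t) (hF0 : F 0 = 0) (t : ℝ) :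
    sn (F t) = Real.sin t := by
  obtain ⟨hc2, h0, h1, hode⟩ := hsn
  have hd : ∀ x, HasDerivAt sn (deriv sn x) x := fun x =>
    (hc2.differentiable (by norm_num) x).hasDerivAt
  have hc1 : ContDiff ℝ 1 (deriv sn) :=
    ((contDiff_succ_iff_deriv (n := 1)).1 (by simpa [one_add_one_eq_two] using hc2)).2.2
  have hdd : ∀ x, HasDerivAt (deriv sn) (-(1 + k ^ 2) * sn x + 2 * k ^ 2 * sn x ^ 3) x := fun x => by
    rw [← hode x]
    exact (hc1.differentiable (by norm_num) x).hasDerivAt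
  have hFc : Continuous F := continuous_iff_continuousAt.2 fun t => (hF t).continuousAt
  let c : ℝ → ℝ := fun t => -(1 + k ^ 2) + 2 * k ^ 2 *
    (sn (F t) ^ 2 + sn (F t) * Real.sin t + Real.sin t ^ 2)
  have hcc : Continuous c := by
    have := hc2.continuous
    simp only [c]; fun_prop
  have hnz : ∀ t, dl k t ≠ 0 := fun t => (dl_pos hk t).ne'
  let v : ℝ → ℝ × ℝ → ℝ × ℝ := fun t p => (p.2 / dl k t, c t * p.1 / dl k t)
  let f : ℝ → ℝ × ℝ := fun t => (sn (F t) - Real.sin t, deriv sn (F t) - Real.cos t * dl k t)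
  have hf : ∀ t, HasDerivAt f (v t (f t)) t := by
    intro t
    have e1 := ((hd (F t)).comp t (hF t)).sub (Real.hasDerivAt_sin t)
    have e2 := ((hdd (F t)).comp t (hF t)).sub ((Real.hasDerivAt_cos t).mul (dl_hasDerivAt hk t))
    have e3 := e1.prodMk e2
    have e4 : v t (f t) = (deriv sn (F t) * (1 / dl k t) - Real.cos t,
      (-(1 + k ^ 2) * sn (F t) + 2 * k ^ 2 * sn (F t) ^ 3) * (1 / dl k t) -
        (-Real.sin t * dl k t + Real.cos t * (-(k ^ 2 * (Real.sin t * Real.cos t)) / dl k t))) := by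
      simp only [v, f, c]
      have hz := hnz t
      have hs := dl_sq hk t
      have hcs := Real.cos_sq' t
      ext
      · simp only; field_simp
      · simp only
        field_simp
        rw [hs, hcs]
        ring
    rw [e4]; exact e3
  have hg : ∀ t, HasDerivAt (fun _ : ℝ => (0 : ℝ × ℝ)) (v t 0) t := by
    intro t
    have : v t 0 = 0 := by simp [v]
    rw [this]; exact hasDerivAt_const _ _
  let R := |t| + 1
  have hb : ∃ L : ℝ, ∀ s ∈ Icc (-R) R, |1 / dl k s| ≤ L ∧ |c s / dl k s| ≤ L := by
    have k1 : Continuous fun s => 1 / dl k s := continuous_const.div (dl_continuous k) hnz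
    have k2 : Continuous fun s => c s / dl k s := hcc.div (dl_continuous k) hnz
    obtain ⟨L1, h1⟩ := isCompact_Icc.exists_bound_of_continuousOn (s := Icc (-R) R) k1.continuousOn
    obtain ⟨L2, h2⟩ := isCompact_Icc.exists_bound_of_continuousOn (s := Icc (-R) R) k2.continuousOn
    exact ⟨max L1 L2, fun s hs => ⟨(h1 s hs).trans (le_max_left _ _), (h2 s hs).trans (le_max_right _ _)⟩⟩
  obtain ⟨L, hL⟩ := hb
  have hR : 0 < R := by positivity
  have hlip : ∀ s ∈ Ioo (-R) R, LipschitzOnWith (Real.toNNReal L) (v s) univ := by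
    intro s hs
    obtain ⟨l1, l2⟩ := hL s ⟨hs.1.le, hs.2.le⟩
    have hL0 : 0 ≤ L := (abs_nonneg _).trans l1
    refine LipschitzWith.lipschitzOnWith (LipschitzWith.of_dist_le_mul fun p q => ?_)
    rw [Real.coe_toNNReal _ hL0, Prod.dist_eq, Prod.dist_eq]
    have d1 : dist (v s p).1 (v s q).1 = |1 / dl k s| * dist p.2 q.2 := by
      simp only [v, Real.dist_eq]; rw [← abs_mul]; congr 1; ring
    have d2 : dist (v s p).2 (v s q).2 = |c s / dl k s| * dist p.1 q.1 := by
      simp only [v, Real.dist_eq]; rw [← abs_mul]; congr 1; ring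
    rw [d1, d2]
    refine max_le ?_ ?_
    · exact mul_le_mul l1 (le_max_right _ _) dist_nonneg hL0
    · exact mul_le_mul l2 (le_max_left _ _) dist_nonneg hL0
  have huniq := ODE_solution_unique_of_mem_Ioo (v := v) (s := fun _ => univ) (t₀ := 0) hlip
    ⟨by linarith, hR⟩ (f := f) (g := fun _ => 0)
    (fun s _ => ⟨hf s, trivial⟩) (fun s _ => ⟨hg s, trivial⟩)
    (by simp [f, hF0, h0, h1, dl])
  have ht : t ∈ Ioo (-R) R := by
    constructor
    · have := neg_abs_le t; simp only [R]; linarith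
    · have := le_abs_self t; simp only [R]; linarith
  have := congrArg Prod.fst (huniq ht)
  simp only [f, Prod.fst_zero] at this
  linarith

/-- Passing from the Lamé equation to the Ince equation. -/
lemma forward {k : ℝ} (hk : k ∈ Set.Ioo (0:ℝ) 1) {F G : ℝ → ℝ}
    (hF : ∀ t, HasDerivAt F (1 / dl k t) t) (hFpi : ∀ t, F (t + Real.pi) = F t + 2 * ellK k)
    (hFG : ∀ x, F (G x) = x) {q : ℝ → ℝ} {M lam : ℝ}
    (hq : ∀ t, q (F t) = M * k ^ 2 * Real.sin t ^ 2) {ψ : ℝ → ℝ}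
    (hψ : IsFloquetSolution q (2 * ellK k) lam (-1) ψ) :
    ∃ y : ℝ → ℝ, y ≠ 0 ∧ (∀ n : ℕ, ContDiff ℝ n y) ∧ (∀ t, y (t + Real.pi) = - y t) ∧
      ∀ t, (1 - k ^ 2 * Real.sin t ^ 2) * deriv (deriv y) t
        - k ^ 2 * (Real.sin t * Real.cos t) * deriv y t
        + (lam - M * k ^ 2 * Real.sin t ^ 2) * y t = 0 := by
  obtain ⟨hne, hc2, hode, hanti⟩ := hψ
  have hd : ∀ x, HasDerivAt ψ (deriv ψ x) x := fun x =>
    (hc2.differentiable (by norm_num) x).hasDerivAt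
  have hc1 : ContDiff ℝ 1 (deriv ψ) :=
    ((contDiff_succ_iff_deriv (n := 1)).1 (by simpa [one_add_one_eq_two] using hc2)).2.2
  have hdd : ∀ x, HasDerivAt (deriv ψ) ((q x - lam) * ψ x) x := fun x => by
    have : (q x - lam) * ψ x = deriv (deriv ψ) x := by linear_combination hode x
    rw [this]
    exact (hc1.differentiable (by norm_num) x).hasDerivAt
  have hnz : ∀ t, dl k t ≠ 0 := fun t => (dl_pos hk t).ne'
  let y : ℝ → ℝ := fun t => ψ (F t)
  let w : ℝ → ℝ := fun t => deriv ψ (F t)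
  have hy : ∀ t, HasDerivAt y (w t / dl k t) t := fun t => by
    have := (hd (F t)).comp t (hF t)
    rw [mul_one_div] at this; exact this
  have hw : ∀ t, HasDerivAt w ((M * k ^ 2 * Real.sin t ^ 2 - lam) * y t / dl k t) t := fun t => by
    have := (hdd (F t)).comp t (hF t)
    rw [mul_one_div, hq] at this; exact this
  have dy : deriv y = fun t => w t / dl k t := funext fun t => (hy t).deriv
  have dw : deriv w = fun t => (M * k ^ 2 * Real.sin t ^ 2 - lam) * y t / dl k t :=
    funext fun t => (hw t).deriv
  have hsm : ∀ n : ℕ, ContDiff ℝ n y ∧ ContDiff ℝ n w := by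
    intro n
    induction n with
    | zero =>
      refine ⟨contDiff_zero.2 ?_, contDiff_zero.2 ?_⟩
      · exact continuous_iff_continuousAt.2 fun t => (hy t).continuousAt
      · exact continuous_iff_continuousAt.2 fun t => (hw t).continuousAt
    | succ n ih =>
      obtain ⟨i1, i2⟩ := ih
      have id := dl_contDiff hk (n : WithTop ℕ∞)
      have is : ContDiff ℝ (n : WithTop ℕ∞) Real.sin := Real.contDiff_sin
      push_cast
      constructor
      · rw [contDiff_succ_iff_deriv]
        refine ⟨fun t => (hy t).differentiableAt, by simp, ?_⟩
        rw [dy]; exact i2.div id hnz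
      · rw [contDiff_succ_iff_deriv]
        refine ⟨fun t => (hw t).differentiableAt, by simp, ?_⟩
        rw [dw]; refine ContDiff.div ?_ id hnz
        fun_prop
  refine ⟨y, ?_, fun n => (hsm n).1, ?_, ?_⟩
  · intro h
    apply hne
    ext x
    have := congrFun h (G x)
    simpa [y, hFG] using this
  · intro t
    simp only [y]
    rw [hFpi, hanti]; ring
  · intro t
    have h2 := (hw t).div (dl_hasDerivAt hk t) (hnz t)
    have h3 := h2.deriv
    change deriv (fun t => w t / dl k t) t = _ at h3
    rw [dy, h3]
    have hs := dl_sq hk t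
    have hz := hnz t
    simp only
    rw [← hs]
    field_simp
    ring

/-- Passing from the Ince equation to the Lamé equation. -/
lemma backward {k : ℝ} (hk : k ∈ Set.Ioo (0:ℝ) 1) {F G : ℝ → ℝ}
    (hFpi : ∀ t, F (t + Real.pi) = F t + 2 * ellK k)
    (hGF : ∀ t, G (F t) = t) (hFG : ∀ x, F (G x) = x) (hG : ∀ x, HasDerivAt G (dl k (G x)) x)
    {q : ℝ → ℝ} {M lam : ℝ}
    (hq : ∀ t, q (F t) = M * k ^ 2 * Real.sin t ^ 2) {y y1 y2 : ℝ → ℝ}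
    (hy : ∀ t, HasDerivAt y (y1 t) t) (hy1 : ∀ t, HasDerivAt y1 (y2 t) t)
    (hne : y ≠ 0) (hanti : ∀ t, y (t + Real.pi) = - y t)
    (hode : ∀ t, (1 - k ^ 2 * Real.sin t ^ 2) * y2 t
        - k ^ 2 * (Real.sin t * Real.cos t) * y1 t
        + (lam - M * k ^ 2 * Real.sin t ^ 2) * y t = 0) :
    IsFloquetSolution q (2 * ellK k) lam (-1) (fun x => y (G x)) := by
  have hnz : ∀ t, dl k t ≠ 0 := fun t => (dl_pos hk t).ne'
  have h1 : ∀ x, HasDerivAt (fun x => y (G x)) (y1 (G x) * dl k (G x)) x := fun x =>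
    (hy (G x)).comp x (hG x)
  have h2 : ∀ x, HasDerivAt (fun x => y1 (G x) * dl k (G x))
      ((M * k ^ 2 * Real.sin (G x) ^ 2 - lam) * y (G x)) x := fun x => by
    have := ((hy1 (G x)).comp x (hG x)).mul ((dl_hasDerivAt hk (G x)).comp x (hG x))
    have e : (M * k ^ 2 * Real.sin (G x) ^ 2 - lam) * y (G x) =
      y2 (G x) * dl k (G x) * dl k (G x)
      + y1 (G x) * (-(k ^ 2 * (Real.sin (G x) * Real.cos (G x))) / dl k (G x) * dl k (G x)) := by
      have hs := dl_sq hk (G x)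
      rw [div_mul_cancel₀ _ (hnz _)]
      linear_combination -hode (G x) - y2 (G x) * hs
    rw [e]; exact this
  have d1 : deriv (fun x => y (G x)) = fun x => y1 (G x) * dl k (G x) := funext fun x => (h1 x).deriv
  have d2 : deriv (fun x => y1 (G x) * dl k (G x)) =
    fun x => (M * k ^ 2 * Real.sin (G x) ^ 2 - lam) * y (G x) := funext fun x => (h2 x).deriv
  refine ⟨?_, ?_, ?_, ?_⟩
  · intro h
    apply hne
    ext t
    have := congrFun h (F t)
    simpa [hGF] using this
  · rw [← one_add_one_eq_two, contDiff_succ_iff_deriv]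
    refine ⟨fun x => (h1 x).differentiableAt, by simp, ?_⟩
    rw [d1, contDiff_one_iff_deriv]
    refine ⟨fun x => (h2 x).differentiableAt, ?_⟩
    rw [d2]
    have c0 : Continuous fun x => y (G x) := continuous_iff_continuousAt.2 fun x => (h1 x).continuousAt
    have cG : Continuous G := continuous_iff_continuousAt.2 fun x => (hG x).continuousAt
    exact Continuous.mul (by fun_prop) c0
  · intro x
    rw [d1, d2]
    have := hq (G x)
    rw [hFG] at this
    rw [this]; ring
  · intro x
    have : G (x + 2 * ellK k) = G x + Real.pi := by
      rw [← hGF (G x + Real.pi), hFpi, hFG]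
    simp only [this, hanti]; ring
lemma tri_row (ν i : ℕ) (hi : i < ν) (d s p a : ℕ → ℝ) (hs : s (ν - 1) = 0) :
    (∑ j : Fin ν, (if i = (j : ℕ) then d i else if (j : ℕ) = i + 1 then s i
      else if i = (j : ℕ) + 1 then p j else 0) * a j)
    = d i * a i + s i * a (i + 1) + (if i = 0 then 0 else p (i - 1) * a (i - 1)) := by
  rw [Fin.sum_univ_eq_sum_range (fun j => (if i = j then d i else if j = i + 1 then s i
      else if i = j + 1 then p j else 0) * a j) ν]
  have h1 : ∀ j ∈ Finset.range ν, (if i = j then d i else if j = i + 1 then s i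
      else if i = j + 1 then p j else 0) * a j
      = (if i = j then d i * a i else 0) + (if i + 1 = j then s i * a (i + 1) else 0)
        + (if i - 1 = j then (if i = 0 then 0 else p (i - 1) * a (i - 1)) else 0) := by
    intro j _
    rcases Nat.eq_zero_or_pos i with h | h
    · subst h
      rcases Nat.eq_zero_or_pos j with h | h
      · subst h; simp
      · have e1 : (0:ℕ) ≠ j := by omega
        by_cases e2 : j = 1
        · subst e2; simp
        · have e3 : 1 ≠ j := fun h => e2 h.symm
          simp [e1, e2, e3]
    · have hi0 : i ≠ 0 := by omega
      by_cases e1 : i = j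
      · subst e1
        have : i - 1 ≠ i := by omega
        simp [this]
      · by_cases e2 : j = i + 1
        · subst e2
          have : i - 1 ≠ i + 1 := by omega
          simp [this]
        · have e2' : i + 1 ≠ j := fun h => e2 h.symm
          by_cases e3 : i = j + 1
          · subst e3
            rw [if_neg e1, if_neg e2, if_pos rfl, if_neg e1, if_neg e2', if_pos (by omega), if_neg hi0]
            simp
          · have e4 : i - 1 ≠ j := by omega
            simp [e1, e2, e2', e3, e4]
  rw [Finset.sum_congr rfl h1, Finset.sum_add_distrib, Finset.sum_add_distrib,
    Finset.sum_ite_eq, Finset.sum_ite_eq, Finset.sum_ite_eq]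
  have m1 : i ∈ Finset.range ν := Finset.mem_range.2 hi
  have m3 : i - 1 ∈ Finset.range ν := Finset.mem_range.2 (by omega)
  rw [if_pos m1, if_pos m3]
  split_ifs with h2
  · rfl
  · rfl
  · rw [Finset.mem_range] at h2
    have : i = ν - 1 := by omega
    rw [this, hs]; ring
  · rw [Finset.mem_range] at h2
    have : i = ν - 1 := by omega
    rw [this, hs]; ring

lemma tri_zero (ν : ℕ) (K : Matrix (Fin ν) (Fin ν) ℝ) (hdet : K.det ≠ 0) (d s p a : ℕ → ℝ)
    (hK : ∀ i j : Fin ν, K i j = if (i : ℕ) = (j : ℕ) then d i else if (j : ℕ) = (i : ℕ) + 1 then s i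
      else if (i : ℕ) = (j : ℕ) + 1 then p j else 0)
    (hs : s (ν - 1) = 0) (h0 : d 0 * a 0 + s 0 * a 1 = 0)
    (hN : ∀ n, p n * a n + d (n + 1) * a (n + 1) + s (n + 1) * a (n + 2) = 0) :
    ∀ n, n < ν → a n = 0 := by
  have hv : K.mulVec (fun j : Fin ν => a j) = 0 := by
    ext i
    simp only [Matrix.mulVec, dotProduct, hK, Pi.zero_apply]
    rw [tri_row ν i i.2 d s p a hs]
    rcases Nat.eq_zero_or_pos (i : ℕ) with h | h
    · rw [h]; simpa using h0
    · obtain ⟨n, hn⟩ : ∃ n, (i : ℕ) = n + 1 := ⟨i - 1, by omega⟩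
      rw [hn, if_neg (by omega), Nat.add_sub_cancel]
      linear_combination hN n
  have := Matrix.eq_zero_of_mulVec_eq_zero hdet hv
  intro n hn
  exact congrFun this ⟨n, hn⟩

lemma deriv_anti {y : ℝ → ℝ} {T : ℝ} (hy : ∀ t, y (t + T) = - y t) (t : ℝ) :
    deriv y (t + T) = - deriv y t := by
  have : (fun t => y (t + T)) = fun t => - y t := funext hy
  have h2 := congrArg (fun f => deriv f t) this
  simpa [deriv_comp_add_const] using h2

lemma fc_deriv_real {y : ℝ → ℝ} (hs : ContDiff ℝ 1 y) (hy : ∀ t, y (t + Real.pi) = - y t) (n : ℤ) :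
    fc (fun t => ((deriv y t : ℝ) : ℂ)) n = Complex.I * n * fc (fun t => (y t : ℂ)) n := by
  refine fc_deriv (fun t => ?_) ?_ ?_ n
  · exact (hs.differentiable (by norm_num) t).hasDerivAt.ofReal_comp
  · exact Complex.continuous_ofReal.comp (hs.continuous_deriv (by norm_num))
  · have h1 := hy Real.pi
    have h2 := hy 0
    rw [zero_add] at h2
    rw [two_mul, h1, h2, neg_neg]

lemma smooth_deriv {y : ℝ → ℝ} (hs : ∀ n : ℕ, ContDiff ℝ n y) (n : ℕ) : ContDiff ℝ n (deriv y) := by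
  have := hs (n + 1)
  push_cast at this
  exact (contDiff_succ_iff_deriv.1 this).2.2

lemma fc_decay {y : ℝ → ℝ} (hs : ∀ n : ℕ, ContDiff ℝ n y) (hy : ∀ t, y (t + Real.pi) = - y t) :
    ∃ D, ∀ n : ℤ, ‖fc (fun t => (y t : ℂ)) n‖ * (n:ℝ) ^ 4 ≤ D := by
  have s1 := smooth_deriv hs
  have s2 := smooth_deriv s1
  have s3 := smooth_deriv s2
  have a1 := deriv_anti hy
  have a2 := deriv_anti a1
  have a3 := deriv_anti a2
  obtain ⟨D, hD⟩ := fc_bound (fun t => ((deriv (deriv (deriv (deriv y))) t : ℝ) : ℂ))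
  refine ⟨D, fun n => ?_⟩
  have h := hD n
  rw [fc_deriv_real (s3 1) a3, fc_deriv_real (s2 1) a2, fc_deriv_real (s1 1) a1,
    fc_deriv_real (hs 1) hy] at h
  simp only [norm_mul, Complex.norm_I, Complex.norm_intCast, one_mul] at h
  calc _ = |(n:ℝ)| * (|(n:ℝ)| * (|(n:ℝ)| * (|(n:ℝ)| * ‖fc (fun t => (y t : ℂ)) n‖))) := by
        rw [show (n:ℝ) ^ 4 = |(n:ℝ)| ^ 4 by rw [Even.pow_abs (by decide)]]; ring
    _ ≤ D := h

lemma B_summable {B : ℤ → ℂ} {D : ℝ} (hD : ∀ j : ℤ, ‖B j‖ * (2 * (j:ℝ) + 1) ^ 4 ≤ D) :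
    Summable fun j : ℤ => ‖B j‖ * (2 * (j:ℝ) + 1) ^ 2 := by
  have h1 : Summable fun n : ℤ => 1 / (n : ℝ) ^ 2 := Real.summable_one_div_int_pow.2 (by norm_num)
  have h2 : Summable fun j : ℤ => D * (1 / (((2 * j + 1 : ℤ)) : ℝ) ^ 2) :=
    (h1.comp_injective (i := fun j : ℤ => 2 * j + 1) (fun a b h => by simpa using h)).mul_left D
  refine h2.of_nonneg_of_le (fun j => by positivity) (fun j => ?_)
  have hz : (2 * (j:ℝ) + 1) ≠ 0 := by
    have : (2 * j + 1 : ℤ) ≠ 0 := by omega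
    exact_mod_cast this
  push_cast
  rw [mul_one_div, le_div_iff₀ (by positivity)]
  calc _ = ‖B j‖ * (2 * (j:ℝ) + 1) ^ 4 := by ring
    _ ≤ D := hD j

lemma indep {B : ℤ → ℂ} (hB : Summable fun j => ‖B j‖) (j0 : ℤ) (h1 : B j0 ≠ 0) (h2 : B (-j0 - 1) = 0)
    (a b : ℝ) (h : ∀ t, a * (∑' j, B j * ee (2 * j + 1) t).re + b * (∑' j, B j * ee (2 * j + 1) t).im = 0) :
    a = 0 ∧ b = 0 := by
  let u : ℝ → ℂ := fun t => ∑' j, B j * ee (2 * j + 1) t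
  let z : ℂ := a - b * Complex.I
  have hz : ∀ t, (starRingEnd ℂ) (z * u t) = - (z * u t) := by
    intro t
    have := h t
    change a * (u t).re + b * (u t).im = 0 at this
    apply Complex.ext
    · simp [z]; linarith
    · simp [z]; ring
  have e1 : fc (fun t => z * u t) (2 * j0 + 1) = z * (2 * Real.pi * B j0) := by
    rw [fc_const_mul, fc_tsum hB]
  have e2 : fc (fun t => z * u t) (2 * (-j0 - 1) + 1) = 0 := by
    rw [fc_const_mul, fc_tsum hB, h2]; simp
  have e3 : (starRingEnd ℂ) (fc (fun t => z * u t) (2 * (-j0 - 1) + 1))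
      = - fc (fun t => z * u t) (2 * j0 + 1) := by
    unfold fc
    rw [← intervalIntegral.intervalIntegral_conj, ← intervalIntegral.integral_neg]
    congr 1; ext t
    rw [map_mul, hz, ee_conj, show -(-(2 * (-j0 - 1) + 1)) = -(2 * j0 + 1) by ring]
    ring
  rw [e1, e2, map_zero, eq_comm, neg_eq_zero] at e3
  have hpi : (Real.pi : ℂ) ≠ 0 := by exact_mod_cast Real.pi_ne_zero
  have z0 : z = 0 := by
    rcases mul_eq_zero.1 e3 with h | h
    · exact h
    · exfalso; exact (mul_ne_zero (mul_ne_zero two_ne_zero hpi) h1) h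
  have r1 := congrArg Complex.re z0
  have r2 := congrArg Complex.im z0
  simp [z] at r1 r2
  exact ⟨r1, r2⟩

lemma complex_real_ode {k lam M s c : ℝ} {w0 w1 w2 : ℂ}
    (h : (1 - (k:ℂ) ^ 2 * (s : ℂ) ^ 2) * w2 - (k:ℂ) ^ 2 * ((s : ℂ) * c) * w1
      + (lam - M * (k:ℂ) ^ 2 * (s : ℂ) ^ 2) * w0 = 0) :
    ((1 - k ^ 2 * s ^ 2) * w2.re - k ^ 2 * (s * c) * w1.re + (lam - M * k ^ 2 * s ^ 2) * w0.re = 0) ∧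
    ((1 - k ^ 2 * s ^ 2) * w2.im - k ^ 2 * (s * c) * w1.im + (lam - M * k ^ 2 * s ^ 2) * w0.im = 0) := by
  have h' : ((1 - k ^ 2 * s ^ 2 : ℝ) : ℂ) * w2 - ((k ^ 2 * (s * c) : ℝ) : ℂ) * w1
      + ((lam - M * k ^ 2 * s ^ 2 : ℝ) : ℂ) * w0 = 0 := by
    push_cast; exact h
  have r := congrArg Complex.re h'
  have i := congrArg Complex.im h'
  simp only [Complex.add_re, Complex.sub_re, Complex.re_ofReal_mul, Complex.zero_re,
    Complex.add_im, Complex.sub_im, Complex.im_ofReal_mul, Complex.zero_im] at r i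
  exact ⟨r, i⟩

/-- Let `m = 2ν`. If `λ` belongs to the `2K`-antiperiodic
spectrum of the Lamé operator `L_m = -d²/dx² + m(m+1)k² sn²(x,k)` and has
multiplicity `1`, then `λ ∈ S*_ν = S*_{ν,1} ∪ S*_{ν,2}`, i.e.
`det K*_{ν,1}(λ) = 0` or `det K*_{ν,2}(λ) = 0`. -/
theorem simple_antiperiodic_eigenvalue_mem_Sstar
    (ν : ℕ) (k : ℝ) (hk : k ∈ Set.Ioo (0:ℝ) 1)
    (sn : ℝ → ℝ) (hsn : IsJacobiSn k sn) (lam : ℝ)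
    (hev : IsAntiperiodicEV (lamePot (2 * ν) k sn) (2 * ellK k) lam)
    (hsimple : ¬ IsDoubleAntiperiodicEV (lamePot (2 * ν) k sn) (2 * ellK k) lam) :
    (matK1s ν k lam).det = 0 ∨ (matK2s ν k lam).det = 0 := by
  by_contra hcon
  rw [not_or] at hcon
  obtain ⟨hdet1, hdet2⟩ := hcon
  apply hsimple
  obtain ⟨ψ, hψ⟩ := hev
  obtain ⟨F, G, hF, hF0, hFpi, hGF, hFG, hG⟩ := exists_am hk
  let M : ℝ := (2 * (ν:ℝ)) * (2 * (ν:ℝ) + 1)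
  have hq : ∀ t, lamePot (2 * ν) k sn (F t) = M * k ^ 2 * Real.sin t ^ 2 := by
    intro t
    simp only [lamePot, M, sn_am hk hsn hF hF0 t]
    push_cast; ring
  obtain ⟨y, hy0, hys, hya, hyode⟩ := forward hk hF hFpi hFG hq hψ
  let yc : ℝ → ℂ := fun t => (y t : ℂ)
  have hycc : Continuous yc := Complex.continuous_ofReal.comp (hys 0).continuous
  have hyca : ∀ t, yc (t + Real.pi) = - yc t := fun t => by simp [yc, hya]
  have s1 := smooth_deriv hys
  have s2 := smooth_deriv s1
  have hper : ∀ z : ℝ → ℝ, (∀ t, z (t + Real.pi) = - z t) → ∀ t, z (t + 2 * Real.pi) = z t := by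
    intro z hz t
    rw [two_mul, ← add_assoc, hz, hz, neg_neg]
  -- the coefficients and their recurrence
  let C : ℤ → ℂ := fun j => fc yc (2 * j + 1)
  have hrecC : ∀ j : ℤ, (k:ℂ) ^ 2 / 4 * (M - (2 * j - 1) ^ 2 - (2 * j - 1)) * C (j - 1)
      + (lam - M * (k:ℂ) ^ 2 / 2 - (1 - (k:ℂ) ^ 2 / 2) * (2 * j + 1) ^ 2) * C j
      + (k:ℂ) ^ 2 / 4 * (M - (2 * j + 3) ^ 2 + (2 * j + 3)) * C (j + 1) = 0 := by
    intro j
    have h := fc_rec (f := yc) (f1 := fun t => ((deriv y t : ℝ) : ℂ))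
      (f2 := fun t => ((deriv (deriv y) t : ℝ) : ℂ))
      (fun t => ((hys 1).differentiable (by norm_num) t).hasDerivAt.ofReal_comp)
      (fun t => ((s1 1).differentiable (by norm_num) t).hasDerivAt.ofReal_comp)
      (Complex.continuous_ofReal.comp (s2 0).continuous)
      (by simpa [yc] using hper y hya 0)
      (by simpa using hper _ (deriv_anti hya) 0) k lam M
      (fun t => by simp only [yc]; exact_mod_cast hyode t) (2 * j + 1)
    simp only [C]
    rw [show 2 * j + 1 - 2 = 2 * (j - 1) + 1 by ring, show 2 * j + 1 + 2 = 2 * (j + 1) + 1 by ring] at h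
    push_cast at h
    linear_combination h
  have hconj : ∀ j : ℤ, C (-j - 1) = (starRingEnd ℂ) (C j) := by
    intro j
    simp only [C, yc]
    rw [fc_conj]; congr 1; ring
  -- real forms of the recurrence
  have hPs : ∀ z : ℝ, lamePs (2 * ν) k z = k ^ 2 / 4 * (M - (2 * z - 1) ^ 2 - (2 * z - 1)) := by
    intro z; simp only [lamePs, M]; push_cast; ring
  have hLs : ∀ n : ℕ, lameLs (2 * ν) k lam n
      = lam - M * k ^ 2 / 2 - (1 - k ^ 2 / 2) * (2 * (n:ℝ) + 1) ^ 2 := by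
    intro n; simp only [lameLs, M]; push_cast; ring
  have hrecR : ∀ j : ℤ, ((k ^ 2 / 4 * (M - (2 * j - 1) ^ 2 - (2 * j - 1)) : ℝ) : ℂ) * C (j - 1)
      + ((lam - M * k ^ 2 / 2 - (1 - k ^ 2 / 2) * (2 * j + 1) ^ 2 : ℝ) : ℂ) * C j
      + ((k ^ 2 / 4 * (M - (2 * j + 3) ^ 2 + (2 * j + 3)) : ℝ) : ℂ) * C (j + 1) = 0 := by
    intro j; push_cast; exact hrecC j
  have hre : ∀ j : ℤ, (k ^ 2 / 4 * (M - (2 * j - 1) ^ 2 - (2 * j - 1))) * (C (j - 1)).re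
      + (lam - M * k ^ 2 / 2 - (1 - k ^ 2 / 2) * (2 * j + 1) ^ 2) * (C j).re
      + (k ^ 2 / 4 * (M - (2 * j + 3) ^ 2 + (2 * j + 3))) * (C (j + 1)).re = 0 := by
    intro j
    have := congrArg Complex.re (hrecR j)
    simpa only [Complex.add_re, Complex.re_ofReal_mul, Complex.zero_re] using this
  have him : ∀ j : ℤ, (k ^ 2 / 4 * (M - (2 * j - 1) ^ 2 - (2 * j - 1))) * (C (j - 1)).im
      + (lam - M * k ^ 2 / 2 - (1 - k ^ 2 / 2) * (2 * j + 1) ^ 2) * (C j).im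
      + (k ^ 2 / 4 * (M - (2 * j + 3) ^ 2 + (2 * j + 3))) * (C (j + 1)).im = 0 := by
    intro j
    have := congrArg Complex.im (hrecR j)
    simpa only [Complex.add_im, Complex.im_ofReal_mul, Complex.zero_im] using this
  have hm1 : C (-1) = (starRingEnd ℂ) (C 0) := by simpa using hconj 0
  -- the low coefficients vanish
  have hzero : ∀ n : ℕ, n < ν → C n = 0 := by
    intro n hn
    have hν : 1 ≤ ν := by omega
    have hs0 : lamePs (2 * ν) k (-(((ν - 1 : ℕ) : ℝ) + 1)) = 0 := by
      rw [hPs]; push_cast [hν]; simp only [M]; ring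
    have zr : (C n).re = 0 := by
      refine tri_zero ν (matK1s ν k lam) hdet1
        (fun i => if i = 0 then lamePs (2 * ν) k 0 + lameLs (2 * ν) k lam 0 else lameLs (2 * ν) k lam i)
        (fun i => lamePs (2 * ν) k (-((i : ℝ) + 1))) (fun j => lamePs (2 * ν) k ((j : ℝ) + 1))
        (fun n => (C n).re) (fun i j => rfl) hs0 ?_ ?_ n hn
      · have h := hre 0
        simp only [zero_sub, hm1, Complex.conj_re, zero_add] at h
        simp only [if_true, hPs, hLs]
        push_cast at h ⊢
        linear_combination h
      · intro n
        have h := hre (n + 1)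
        simp only [Nat.succ_ne_zero, if_false, hPs, hLs]
        rw [add_sub_cancel_right, show (n:ℤ) + 1 + 1 = n + 2 by ring] at h
        push_cast at h ⊢
        norm_num at h ⊢
        linear_combination h
    have zi : (C n).im = 0 := by
      refine tri_zero ν (matK2s ν k lam) hdet2
        (fun i => if i = 0 then -lamePs (2 * ν) k 0 + lameLs (2 * ν) k lam 0 else lameLs (2 * ν) k lam i)
        (fun i => lamePs (2 * ν) k (-((i : ℝ) + 1))) (fun j => lamePs (2 * ν) k ((j : ℝ) + 1))
        (fun n => (C n).im) (fun i j => rfl) hs0 ?_ ?_ n hn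
      · have h := him 0
        simp only [zero_sub, hm1, Complex.conj_im, zero_add] at h
        simp only [if_true, hPs, hLs]
        push_cast at h ⊢
        linear_combination h
      · intro n
        have h := him (n + 1)
        simp only [Nat.succ_ne_zero, if_false, hPs, hLs]
        rw [add_sub_cancel_right, show (n:ℤ) + 1 + 1 = n + 2 by ring] at h
        push_cast at h ⊢
        norm_num at h ⊢
        linear_combination h
    exact Complex.ext zr zi
  -- some high coefficient does not vanish
  have hex : ∃ j0 : ℤ, (ν : ℤ) ≤ j0 ∧ C j0 ≠ 0 := by
    by_contra hno
    push Not at hno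
    have hpos : ∀ j : ℤ, 0 ≤ j → C j = 0 := by
      intro j hj
      by_cases h : (ν : ℤ) ≤ j
      · exact hno j h
      · obtain ⟨n, rfl⟩ := Int.eq_ofNat_of_zero_le hj
        exact hzero n (by omega)
    have hall : ∀ j : ℤ, C j = 0 := by
      intro j
      by_cases h : 0 ≤ j
      · exact hpos j h
      · have h1 := hconj (-j - 1)
        rw [hpos (-j - 1) (by omega), map_zero, show -(-j - 1) - 1 = j by ring] at h1
        exact h1
    have hyz : yc = 0 := by
      refine fc_complete hycc (fun t => ?_) fun n => ?_
      · rw [two_mul, ← add_assoc, hyca, hyca, neg_neg]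
      · rcases Int.even_or_odd' n with ⟨j, h | h⟩
        · rw [h]; exact fc_even hycc hyca j
        · rw [h]; exact hall j
    apply hy0
    ext t
    have := congrFun hyz t
    simpa [yc] using this
  obtain ⟨j0, hj0, hCj0⟩ := hex
  -- the truncated sequence
  let B : ℤ → ℂ := fun j => if (ν : ℤ) ≤ j then C j else 0
  have hBj0 : B j0 ≠ 0 := by simp only [B, if_pos hj0]; exact hCj0
  have hBj0' : B (-j0 - 1) = 0 := by
    simp only [B]; rw [if_neg (by omega)]
  have hrecB : ∀ j : ℤ, (k:ℂ) ^ 2 / 4 * (M - (2 * j - 1) ^ 2 - (2 * j - 1)) * B (j - 1)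
      + (lam - M * (k:ℂ) ^ 2 / 2 - (1 - (k:ℂ) ^ 2 / 2) * (2 * j + 1) ^ 2) * B j
      + (k:ℂ) ^ 2 / 4 * (M - (2 * j + 3) ^ 2 + (2 * j + 3)) * B (j + 1) = 0 := by
    intro j
    rcases lt_or_ge (j + 1) ν with h1 | h1
    · simp only [B]
      rw [if_neg (by omega), if_neg (by omega), if_neg (by omega)]; ring
    · rcases h1.eq_or_lt with h2 | h2
      · have hj : j = (ν : ℤ) - 1 := by omega
        simp only [B]
        rw [if_neg (by omega), if_neg (by omega), hj]
        simp only [M]; push_cast; ring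
      · rcases (show (ν : ℤ) ≤ j by omega).eq_or_lt with h3 | h3
        · have h := hrecC j
          have hz : (k:ℂ) ^ 2 / 4 * (M - (2 * j - 1) ^ 2 - (2 * j - 1)) * C (j - 1) = 0 := by
            rcases Nat.eq_zero_or_pos ν with h4 | h4
            · rw [← h3]; simp only [M, h4]; push_cast; ring
            · have : j - 1 = ((ν - 1 : ℕ) : ℤ) := by omega
              rw [this, hzero _ (by omega), mul_zero]
          simp only [B]
          rw [if_neg (by omega), if_pos (by omega), if_pos (by omega)]
          linear_combination h - hz
        · simp only [B]
          rw [if_pos (by omega), if_pos (by omega), if_pos (by omega)]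
          exact hrecC j
  obtain ⟨D, hD⟩ := fc_decay hys hya
  have hBD : ∀ j : ℤ, ‖B j‖ * (2 * (j:ℝ) + 1) ^ 4 ≤ D := by
    intro j
    have h := hD (2 * j + 1)
    push_cast at h
    by_cases hj : (ν : ℤ) ≤ j
    · simp only [B, if_pos hj]; exact h
    · simp only [B, if_neg hj, norm_zero, zero_mul]
      exact le_trans (by positivity) h
  have hBs := B_summable hBD
  have hBs0 : Summable fun j => ‖B j‖ := by
    refine hBs.of_nonneg_of_le (fun j => norm_nonneg _) (fun j => ?_)
    have h1 : (1:ℤ) ≤ (2 * j + 1) ^ 2 := by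
      have : 0 ≤ j * (j + 1) := by
        rcases le_or_gt 0 j with h | h
        · positivity
        · nlinarith
      nlinarith
    have h2 : (1:ℝ) ≤ (2 * (j:ℝ) + 1) ^ 2 := by exact_mod_cast h1
    nlinarith [norm_nonneg (B j)]
  obtain ⟨u1, u2, hu, hu1, hode⟩ := series_ode hBs k lam M hrecB
  have hind := indep hBs0 j0 hBj0 hBj0'
  let u : ℝ → ℂ := fun t => ∑' j, B j * ee (2 * j + 1) t
  have hua : ∀ t, u (t + Real.pi) = - u t := by
    intro t
    simp only [u, ee_add_pi, mul_neg, tsum_neg]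
  have hneR : (fun t => (u t).re) ≠ 0 := by
    intro h
    have := hind 1 0 (fun t => by simpa [u] using congrFun h t)
    exact one_ne_zero this.1
  have hneI : (fun t => (u t).im) ≠ 0 := by
    intro h
    have := hind 0 1 (fun t => by simpa [u] using congrFun h t)
    exact one_ne_zero this.2
  have dre : ∀ {f : ℝ → ℂ} {f' : ℂ} {t : ℝ}, HasDerivAt f f' t → HasDerivAt (fun t => (f t).re) f'.re t :=
    fun h => Complex.reCLM.hasFDerivAt.comp_hasDerivAt _ h
  have dim : ∀ {f : ℝ → ℂ} {f' : ℂ} {t : ℝ}, HasDerivAt f f' t → HasDerivAt (fun t => (f t).im) f'.im t :=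
    fun h => Complex.imCLM.hasFDerivAt.comp_hasDerivAt _ h
  refine ⟨fun x => (u (G x)).re, fun x => (u (G x)).im, ?_, ?_, ?_⟩
  · rw [LinearIndependent.pair_iff]
    intro a b hab
    refine hind a b fun t => ?_
    have := congrFun hab (F t)
    simpa [hGF, u] using this
  · exact backward hk (y := fun t => (u t).re) (y1 := fun t => (u1 t).re) (y2 := fun t => (u2 t).re)
      hFpi hGF hFG hG hq (fun t => dre (hu t)) (fun t => dre (hu1 t)) hneR
      (fun t => by simp [hua]) (fun t => (complex_real_ode (hode t)).1)
  · exact backward hk (y := fun t => (u t).im) (y1 := fun t => (u1 t).im) (y2 := fun t => (u2 t).im)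
      hFpi hGF hFG hG hq (fun t => dim (hu t)) (fun t => dim (hu1 t)) hneI
      (fun t => by simp [hua]) (fun t => (complex_real_ode (hode t)).2)
end
end
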